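/- Let a<b be real, let ψ : ℝ → ]0,+∞[ be a bounded Borel function with ∫_{−∞}^{+∞} ψ(t) dt < +∞ and inf_K ψ > 0 for every compact K ⊂ ℝ, let λ > 0, let g : [a,b] → ℝ be Lipschitz continuous, and let u ∈ X¹_ψ(]a,b[) be a solution of the minimization problem min{ F̄₁(w) + λ∫_a^b (w − g)² dx : w ∈ X¹_ψ(]a,b[) }. Then u is Lipschitz continuous and u' ∈ BV(]a,b[). -/

import Mathlib

open MeasureTheory Filter Set Topology
open scoped ENNReal NNReal

noncomputable section

/-- `Ψ₁(t) = ∫_{-∞}^t ψ(s) ds`. -/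
def Psi1 (ψ : ℝ → ℝ) (t : ℝ) : ℝ := ∫ s in Set.Iic t, ψ s

/-- `Ψ_p(t) = ∫_{-∞}^t ψ(s)^{1/p} ds`. -/
def Psip (ψ : ℝ → ℝ) (p t : ℝ) : ℝ := ∫ s in Set.Iic t, ψ s ^ (1 / p)

/-- The natural extension of `Ψ₁` to the extended reals:
`Ψ₁(-∞) = 0`, `Ψ₁(+∞) = ∫_ℝ ψ`. -/
def Psi1E (ψ : ℝ → ℝ) (t : EReal) : ℝ :=
  if t = ⊤ then ∫ s, ψ s else if t = ⊥ then 0 else Psi1 ψ t.toReal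

/-- Standing assumptions on `ψ` in the case `p = 1`: a bounded, everywhere positive
Borel function, integrable on `ℝ`, whose infimum on every compact set is positive. -/
structure PsiHyp (ψ : ℝ → ℝ) : Prop where
  measurable : Measurable ψ
  pos : ∀ t, 0 < ψ t
  bounded : ∃ C, ∀ t, ψ t ≤ C
  integrable : MeasureTheory.Integrable ψ
  inf_pos : ∀ K : Set ℝ, IsCompact K → ∃ δ > 0, ∀ t ∈ K, δ ≤ ψ t

/-- Standing assumptions on `ψ` in the case `p > 1`: as in `PsiHyp` but with
`ψ^{1/p}` integrable on `ℝ`. -/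
structure PsiHypP (ψ : ℝ → ℝ) (p : ℝ) : Prop where
  measurable : Measurable ψ
  pos : ∀ t, 0 < ψ t
  bounded : ∃ C, ∀ t, ψ t ≤ C
  integrable : MeasureTheory.Integrable fun t => ψ t ^ (1 / p)
  inf_pos : ∀ K : Set ℝ, IsCompact K → ∃ δ > 0, ∀ t ∈ K, δ ≤ ψ t

/-- `(μp, μn)` is the Jordan decomposition of the distributional derivative of
`u ∈ L¹(]a,b[)`; the existence of such a pair encodes `u ∈ BV(]a,b[)`,
and `μp + μn` is the total variation measure `|u'|`. -/
def IsDerivMeasures (a b : ℝ) (u : ℝ → ℝ) (μp μn : Measure ℝ) : Prop :=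
  MeasureTheory.IntegrableOn u (Set.Ioo a b) ∧
  IsFiniteMeasure μp ∧ IsFiniteMeasure μn ∧ μp ⟂ₘ μn ∧
  μp (Set.Ioo a b)ᶜ = 0 ∧ μn (Set.Ioo a b)ᶜ = 0 ∧
  ∀ φ : ℝ → ℝ, ContDiff ℝ 1 φ → tsupport φ ⊆ Set.Ioo a b →
    ∫ x in Set.Ioo a b, u x * deriv φ x = (∫ x, φ x ∂μn) - ∫ x, φ x ∂μp

/-- The density `(u')^a` of the absolutely continuous part of the derivative whose
Jordan decomposition is `(μp, μn)`. -/
def uaD (μp μn : Measure ℝ) (x : ℝ) : ℝ :=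
  (μp.rnDeriv MeasureTheory.volume x).toReal - (μn.rnDeriv MeasureTheory.volume x).toReal

/-- Left approximate limit `u₋(y) = lim_{ε→0⁺} ε⁻¹ ∫_{y-ε}^y u`. -/
def leftApproxLim (u : ℝ → ℝ) (y : ℝ) : ℝ :=
  limUnder (𝓝[>] (0 : ℝ)) fun ε => (∫ x in Set.Ioo (y - ε) y, u x) / ε

/-- Right approximate limit `u₊(y) = lim_{ε→0⁺} ε⁻¹ ∫_y^{y+ε} u`. -/
def rightApproxLim (u : ℝ → ℝ) (y : ℝ) : ℝ :=
  limUnder (𝓝[>] (0 : ℝ)) fun ε => (∫ x in Set.Ioo y (y + ε), u x) / ε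

/-- Left approximate limit computed in the extended reals (may be `±∞`). -/
def leftApproxLimE (u : ℝ → ℝ) (y : ℝ) : EReal :=
  limUnder (𝓝[>] (0 : ℝ)) fun ε => (((∫ x in Set.Ioo (y - ε) y, u x) / ε : ℝ) : EReal)

/-- Right approximate limit computed in the extended reals (may be `±∞`). -/
def rightApproxLimE (u : ℝ → ℝ) (y : ℝ) : EReal :=
  limUnder (𝓝[>] (0 : ℝ)) fun ε => (((∫ x in Set.Ioo y (y + ε), u x) / ε : ℝ) : EReal)

/-- The jump set `S_u` of `u` in `]a,b[`. -/
def jumpSet (a b : ℝ) (u : ℝ → ℝ) : Set ℝ :=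
  {y | y ∈ Set.Ioo a b ∧ leftApproxLim u y ≠ rightApproxLim u y}

/-- `ν_u = sign(u₊ - u₋)`. -/
def jumpSign (u : ℝ → ℝ) (y : ℝ) : ℝ :=
  Real.sign (rightApproxLim u y - leftApproxLim u y)

/-- `Z⁺[w] = {x ∈ ]a,b[ : lim_{ε→0⁺} (2ε)⁻¹∫_{x-ε}^{x+ε} w = +∞}`. -/
def ZPlus (a b : ℝ) (w : ℝ → ℝ) : Set ℝ :=
  {x | x ∈ Set.Ioo a b ∧
    Tendsto (fun ε => (∫ t in Set.Ioo (x - ε) (x + ε), w t) / (2 * ε)) (𝓝[>] (0 : ℝ)) atTop}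

/-- `Z⁻[w] = {x ∈ ]a,b[ : lim_{ε→0⁺} (2ε)⁻¹∫_{x-ε}^{x+ε} w = -∞}`. -/
def ZMinus (a b : ℝ) (w : ℝ → ℝ) : Set ℝ :=
  {x | x ∈ Set.Ioo a b ∧
    Tendsto (fun ε => (∫ t in Set.Ioo (x - ε) (x + ε), w t) / (2 * ε)) (𝓝[>] (0 : ℝ)) atBot}

/-- The positive part `((u')^c)⁺` of the Cantor part of the derivative of `u`:
the singular part of `μp` with the atoms on the jump set removed. -/
def cantorPos (a b : ℝ) (u : ℝ → ℝ) (μp : Measure ℝ) : Measure ℝ :=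
  (μp.singularPart MeasureTheory.volume).restrict (jumpSet a b u)ᶜ

/-- The negative part `((u')^c)⁻` of the Cantor part of the derivative of `u`. -/
def cantorNeg (a b : ℝ) (u : ℝ → ℝ) (μn : Measure ℝ) : Measure ℝ :=
  (μn.singularPart MeasureTheory.volume).restrict (jumpSet a b u)ᶜ

/-- `u ∈ X¹_ψ(]a,b[)`, with derivative data `(μp, μn)`:  `u ∈ BV(]a,b[)`,
`Ψ₁∘(u')^a ∈ BV(]a,b[)`, and `((u')^c)^±` is concentrated on `Z^±[(u')^a]`. -/
def MemX1 (ψ : ℝ → ℝ) (a b : ℝ) (u : ℝ → ℝ) (μp μn : Measure ℝ) : Prop :=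
  IsDerivMeasures a b u μp μn ∧
  (∃ νp νn : Measure ℝ, IsDerivMeasures a b (fun x => Psi1 ψ (uaD μp μn x)) νp νn) ∧
  cantorPos a b u μp (ZPlus a b (uaD μp μn))ᶜ = 0 ∧
  cantorNeg a b u μn (ZMinus a b (uaD μp μn))ᶜ = 0

/-- `f ∈ W^{1,p}(]a,b[)`: `f` has an absolutely continuous representative whose
pointwise a.e. derivative lies in `L^p(]a,b[)`. -/
def MemW1pOn (p a b : ℝ) (f : ℝ → ℝ) : Prop :=
  ∃ g w : ℝ → ℝ,
    (∀ᵐ x ∂(MeasureTheory.volume.restrict (Set.Ioo a b)), g x = f x) ∧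
    MeasureTheory.IntegrableOn w (Set.Ioo a b) ∧
    MeasureTheory.IntegrableOn (fun x => |w x| ^ p) (Set.Ioo a b) ∧
    ∀ x ∈ Set.Ioo a b, ∀ y ∈ Set.Ioo a b, g y - g x = ∫ t in x..y, w t

/-- `u ∈ X^p_ψ(]a,b[)`, with derivative data `(μp, μn)`:  `u ∈ BV(]a,b[)`,
`Ψ_p∘(u')^a ∈ W^{1,p}(]a,b[)`, and `((u')^s)^±` is concentrated on `Z^±[(u')^a]`. -/
def MemXp (ψ : ℝ → ℝ) (p a b : ℝ) (u : ℝ → ℝ) (μp μn : Measure ℝ) : Prop :=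
  IsDerivMeasures a b u μp μn ∧
  MemW1pOn p a b (fun x => Psip ψ p (uaD μp μn x)) ∧
  (μp.singularPart MeasureTheory.volume) (ZPlus a b (uaD μp μn))ᶜ = 0 ∧
  (μn.singularPart MeasureTheory.volume) (ZMinus a b (uaD μp μn))ᶜ = 0

/-- `u ∈ W^{2,p}(]a,b[)` with first derivative `v` and second derivative `w`. -/
def W2pRep (p a b : ℝ) (u v w : ℝ → ℝ) : Prop :=
  (∀ x ∈ Set.Ioo a b, HasDerivAt u (v x) x) ∧
  (∀ x ∈ Set.Ioo a b, ∀ y ∈ Set.Ioo a b, v y - v x = ∫ t in x..y, w t) ∧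
  MeasureTheory.IntegrableOn u (Set.Ioo a b) ∧
  MeasureTheory.IntegrableOn v (Set.Ioo a b) ∧
  MeasureTheory.IntegrableOn w (Set.Ioo a b) ∧
  MeasureTheory.IntegrableOn (fun x => |w x| ^ p) (Set.Ioo a b)

/-- The functional `F_p(u) = ∫_a^b |u'| + ∫_a^b ψ(u')|u''|^p` if `u ∈ W^{2,p}(]a,b[)`,
`+∞` otherwise (as an infimum over Sobolev representations). -/
def Fp (ψ : ℝ → ℝ) (p a b : ℝ) (u : ℝ → ℝ) : ℝ≥0∞ :=
  ⨅ (v : ℝ → ℝ) (w : ℝ → ℝ) (_ : W2pRep p a b u v w),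
    ENNReal.ofReal ((∫ x in Set.Ioo a b, |v x|) + ∫ x in Set.Ioo a b, ψ (v x) * |w x| ^ p)

/-- Strong `L¹(]a,b[)` convergence of a sequence. -/
def TendstoL1 (a b : ℝ) (U : ℕ → ℝ → ℝ) (u : ℝ → ℝ) : Prop :=
  (∀ k, MeasureTheory.IntegrableOn (U k) (Set.Ioo a b)) ∧
  MeasureTheory.IntegrableOn u (Set.Ioo a b) ∧
  Tendsto (fun k => ∫ x in Set.Ioo a b, |U k x - u x|) atTop (𝓝 0)

/-- The relaxed functional
`F̄_p(u) = inf { liminf_k F_p(u_k) : u_k → u in L¹(]a,b[) }`. -/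
def FpRel (ψ : ℝ → ℝ) (p a b : ℝ) (u : ℝ → ℝ) : ℝ≥0∞ :=
  ⨅ (U : ℕ → ℝ → ℝ) (_ : TendstoL1 a b U u),
    liminf (fun k => Fp ψ p a b (U k)) atTop

/-- `Φ(s, t₁, t₂)` of the relaxation formula (`s` being the sign of the jump). -/
def Phi (ψ : ℝ → ℝ) (s : ℝ) (t₁ t₂ : EReal) : ℝ :=
  if 0 < s then ((∫ t, ψ t) - Psi1E ψ t₁) + ((∫ t, ψ t) - Psi1E ψ t₂)
  else Psi1E ψ t₁ + Psi1E ψ t₂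

/-- `Φ̂(s, t₁, t₂)` of Remark 2.5. -/
def PhiHat (ψ : ℝ → ℝ) (s : ℝ) (t₁ t₂ : EReal) : ℝ :=
  if 0 < s then (∫ t, ψ t) - Psi1E ψ (max t₁ t₂)
  else Psi1E ψ (min t₁ t₂)

/-- `ubar` is a `C¹([a,b])` representative of `u`. -/
def C1Rep (a b : ℝ) (u ubar : ℝ → ℝ) : Prop :=
  (∀ᵐ x ∂(MeasureTheory.volume.restrict (Set.Ioo a b)), ubar x = u x) ∧
  ContDiffOn ℝ 1 ubar (Set.Icc a b)

/-- `u` solves `min { F̄₁(w) + λ ∫_a^b (w - G)² : w ∈ X¹_ψ(]a,b[) }`. -/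
def IsSolution1 (ψ : ℝ → ℝ) (a b lam : ℝ) (G u : ℝ → ℝ) : Prop :=
  (∃ μp μn : Measure ℝ, MemX1 ψ a b u μp μn) ∧
  ∀ w : ℝ → ℝ, (∃ ηp ηn : Measure ℝ, MemX1 ψ a b w ηp ηn) →
    FpRel ψ 1 a b u + ENNReal.ofReal (lam * ∫ x in Set.Ioo a b, (u x - G x) ^ 2) ≤
    FpRel ψ 1 a b w + ENNReal.ofReal (lam * ∫ x in Set.Ioo a b, (w x - G x) ^ 2)

/-- `u` solves `min { F̄_p(w) + λ ∫_a^b |w - G|² : w ∈ X^p_ψ(]a,b[) }`. -/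
def IsSolutionP (ψ : ℝ → ℝ) (p a b lam : ℝ) (G u : ℝ → ℝ) : Prop :=
  (∃ μp μn : Measure ℝ, MemXp ψ p a b u μp μn) ∧
  ∀ w : ℝ → ℝ, (∃ ηp ηn : Measure ℝ, MemXp ψ p a b w ηp ηn) →
    FpRel ψ p a b u + ENNReal.ofReal (lam * ∫ x in Set.Ioo a b, (u x - G x) ^ 2) ≤
    FpRel ψ p a b w + ENNReal.ofReal (lam * ∫ x in Set.Ioo a b, (w x - G x) ^ 2)

/-- The Rudin–Osher–Fatemi energy `|w'|(]a,b[) + λ∫_a^b (w-g)²`, where `(ηp, ηn)`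
is the Jordan decomposition of the derivative of `w`. -/
def ROFenergy (a b lam : ℝ) (g w : ℝ → ℝ) (ηp ηn : Measure ℝ) : ℝ≥0∞ :=
  (ηp + ηn) (Set.Ioo a b) + ENNReal.ofReal (lam * ∫ x in Set.Ioo a b, (w x - g x) ^ 2)

/-- The left-continuous generalized inverse `g^{-1}(c) = inf {x ∈ [a,b] : g(x) ≥ c}`. -/
def gInv (a b : ℝ) (g : ℝ → ℝ) (c : ℝ) : ℝ :=
  sInf {x | x ∈ Set.Icc a b ∧ c ≤ g x}

end

noncomputable section
open MeasureTheory Filter Set Topology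
open scoped ENNReal NNReal

theorem absolutelyContinuousOnInterval_const_add_primitive {Q : ℝ → ℝ}
    (hQ : Integrable Q) (k c p r : ℝ) :
    AbsolutelyContinuousOnInterval (fun x => k + ∫ t in c..x, Q t) p r := by
  have h1 : AbsolutelyContinuousOnInterval (fun x => ∫ t in p..x, Q t) p r :=
    hQ.intervalIntegrable.absolutelyContinuousOnInterval_intervalIntegral left_mem_uIcc
  have h2 : AbsolutelyContinuousOnInterval (fun _ : ℝ => k + ∫ t in c..p, Q t) p r :=
    (LipschitzWith.const _).lipschitzOnWith.absolutelyContinuousOnInterval (K := 0)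
  have h3 := h2.add h1
  have : (fun x => k + ∫ t in c..x, Q t) =
      (fun _ : ℝ => k + ∫ t in c..p, Q t) + fun x => ∫ t in p..x, Q t := by
    funext x
    simp only [Pi.add_apply]
    rw [add_assoc, intervalIntegral.integral_add_adjacent_intervals
      hQ.intervalIntegrable hQ.intervalIntegrable]
  rw [this]; exact h3

/-- A Sobolev function on `]a,b[` extends to a `C¹` function on the line, affine outside `[a,b]`. -/
theorem W2pRep.exists_global {a b : ℝ} (hab : a < b) {f v q : ℝ → ℝ}
    (h : W2pRep 1 a b f v q) :
    ∃ F V : ℝ → ℝ, (∀ x ∈ Ioo a b, F x = f x) ∧ (∀ x ∈ Ioo a b, V x = v x) ∧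
      (∀ x, HasDerivAt F (V x) x) ∧ Continuous V ∧ (∀ x ≤ a, V x = V a) ∧
      (∀ x, b ≤ x → V x = V b) ∧ (∀ p r, AbsolutelyContinuousOnInterval V p r) ∧
      (∀ᵐ x ∂(volume.restrict (Ioo a b)), HasDerivAt V (q x) x) := by
  obtain ⟨hf, hv, -, -, hq, -⟩ := h
  set c := (a + b) / 2 with hc
  have hcm : c ∈ Ioo a b := ⟨by linarith, by linarith⟩
  set Q := (Ioo a b).indicator q with hQdef
  have hQ : Integrable Q := (integrable_indicator_iff measurableSet_Ioo).2 hq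
  set V : ℝ → ℝ := fun x => v c + ∫ t in c..x, Q t with hV
  have hVc : Continuous V :=
    continuous_const.add (intervalIntegral.continuous_primitive (fun _ _ => hQ.intervalIntegrable) c)
  have hVv : ∀ x ∈ Ioo a b, V x = v x := by
    intro x hx
    have : ∫ t in c..x, Q t = ∫ t in c..x, q t := by
      apply intervalIntegral.integral_congr
      intro t ht
      have : t ∈ Ioo a b := (ordConnected_Ioo.uIcc_subset hcm hx) ht
      simp [hQdef, this]
    simp only [hV, this, ← hv c hcm x hx]; ring
  have hVdiff : ∀ x y, V y - V x = ∫ t in x..y, Q t := by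
    intro x y
    have := intervalIntegral.integral_interval_sub_left (μ := volume) (f := Q) (a := c) (b := y)
      (c := x) hQ.intervalIntegrable hQ.intervalIntegrable
    simp only [hV]
    linarith
  set F : ℝ → ℝ := fun x => f c + ∫ t in c..x, V t with hF
  have hFd : ∀ x, HasDerivAt F (V x) x := fun x =>
    (intervalIntegral.integral_hasDerivAt_right (hVc.intervalIntegrable _ _)
      (hVc.stronglyMeasurableAtFilter _ _) hVc.continuousAt).const_add _
  refine ⟨F, V, ?_, hVv, hFd, hVc, ?_, ?_, fun p r =>
    absolutelyContinuousOnInterval_const_add_primitive hQ _ _ _ _, ?_⟩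
  · intro x hx
    have hsub : uIcc c x ⊆ Ioo a b := ordConnected_Ioo.uIcc_subset hcm hx
    have h1 : ∫ t in c..x, V t = f x - f c := by
      apply intervalIntegral.integral_eq_sub_of_hasDerivAt _ (hVc.intervalIntegrable _ _)
      intro t ht
      rw [hVv t (hsub ht)]; exact hf t (hsub ht)
    simp [hF, h1]
  · intro x hx
    have := hVdiff x a
    rw [intervalIntegral.integral_zero_ae] at this
    · linarith
    · refine Eventually.of_forall fun t ht => ?_
      rw [uIoc_of_le hx] at ht
      simp [hQdef, ht.2.not_gt]
  · intro x hx
    have := hVdiff b x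
    rw [intervalIntegral.integral_zero_ae] at this
    · linarith
    · refine Eventually.of_forall fun t ht => ?_
      rw [uIoc_of_le hx] at ht
      simp [hQdef, ht.1.le]
  · rw [ae_restrict_iff' measurableSet_Ioo]
    have h1 : IntervalIntegrable Q volume a b := hQ.intervalIntegrable
    filter_upwards [h1.ae_hasDerivAt_integral] with x hx hxm
    have hx' := hx (Icc_subset_uIcc (Ioo_subset_Icc_self hxm)) c
      (Icc_subset_uIcc (Ioo_subset_Icc_self hcm))
    have : Q x = q x := by simp [hQdef, hxm]
    rw [← this]
    exact hx'.const_add _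

theorem le_deriv_of_forall_add_mul_le {F : ℝ → ℝ} {y x d L : ℝ} (hyx : y < x)
    (hF : HasDerivAt F d y) (h : ∀ t ∈ Ioc y x, F y + L * (t - y) ≤ F t) : L ≤ d := by
  have h1 : Tendsto (slope F y) (𝓝[>] y) (𝓝 d) :=
    (hasDerivAt_iff_tendsto_slope.1 hF).mono_left
      (nhdsWithin_mono _ fun t ht => ne_of_gt ht)
  refine ge_of_tendsto h1 ?_
  filter_upwards [Ioc_mem_nhdsGT hyx] with t ht
  rw [slope_def_field, le_div_iff₀ (sub_pos.2 ht.1)]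
  linarith [h t ht]

/-- Limiting the upward slope of `F` by `L` above the obstacle `g`, starting from the left:
the function `P` is the running infimal convolution of `max F g`, and `ξ` selects the contact
points. -/
theorem exists_upper_slope_envelope {a b L : ℝ} {K M : ℝ≥0} {F V g : ℝ → ℝ}
    (hF : ∀ x, HasDerivAt F (V x) x) (hFM : LipschitzWith M F) (hg : LipschitzWith K g)
    (hL : K < L) :
    ∃ (P ξ : ℝ → ℝ) (N : ℝ≥0), (∀ x ∈ Icc a b, g x ≤ P x ∧ P x ≤ max (F x) (g x)) ∧
      (∀ x ∈ Icc a b, ∀ y ∈ Icc a b, x ≤ y → P y - L * y ≤ P x - L * x) ∧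
      LipschitzOnWith N P (Icc a b) ∧ MonotoneOn ξ (Icc a b) ∧ MapsTo ξ (Icc a b) (Icc a b) ∧
      ∀ x ∈ Icc a b, (ξ x = x ∧ P x = max (F x) (g x)) ∨
        (ξ x < x ∧ g (ξ x) ≤ F (ξ x) ∧ L ≤ V (ξ x) ∧ g x < F x ∧
          (x ∈ Ioo a b → HasDerivAt P L x)) := by
  set h : ℝ → ℝ := fun y => max (F y) (g y) - L * y with hh
  have hL0 : 0 < L := lt_of_le_of_lt K.2 hL
  have hhL : LipschitzWith (max M K + ⟨L, hL0.le⟩) h := by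
    refine (hFM.max hg).sub ?_
    refine LipschitzWith.of_dist_le_mul fun x y => ?_
    rw [Real.dist_eq, Real.dist_eq, ← mul_sub, abs_mul, abs_of_pos hL0]
    rfl
  set N := max M K + ⟨L, hL0.le⟩ with hN
  have hhc : Continuous h := hhL.continuous
  have hgK : ∀ s t, s ≤ t → g t - g s ≤ K * (t - s) ∧ g s - g t ≤ K * (t - s) := by
    intro s t hst
    have := hg.dist_le_mul s t
    rw [Real.dist_eq, Real.dist_eq, abs_sub_comm s t, abs_of_nonneg (sub_nonneg.2 hst)] at this
    exact ⟨by linarith [neg_abs_le (g s - g t)], by linarith [le_abs_self (g s - g t)]⟩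
  have key : ∀ x, ∃ y, a ≤ x → y ∈ Icc a x ∧ (∀ t ∈ Icc a x, h y ≤ h t) ∧
      ∀ y' ∈ Icc a x, (∀ t ∈ Icc a x, h y' ≤ h t) → y' ≤ y := by
    intro x
    by_cases hx : a ≤ x
    · obtain ⟨y0, hy0, hmin⟩ := isCompact_Icc.exists_isMinOn (nonempty_Icc.2 hx) hhc.continuousOn
      have hc : IsCompact (Icc a x ∩ {y | h y ≤ h y0}) :=
        isCompact_Icc.inter_right (isClosed_le hhc continuous_const)
      obtain ⟨y, hy, hyg⟩ := hc.exists_isGreatest ⟨y0, hy0, le_refl (h y0)⟩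
      refine ⟨y, fun _ => ⟨hy.1, fun t ht => le_trans hy.2 (hmin ht), fun y' hy' hm => ?_⟩⟩
      exact hyg ⟨hy', hm y0 hy0⟩
    · exact ⟨x, fun h => absurd h hx⟩
  choose ξ hξ using key
  have hmem : ∀ x, a ≤ x → a ≤ ξ x ∧ ξ x ≤ x := fun x hx => (hξ x hx).1
  have hmin : ∀ x, a ≤ x → ∀ t ∈ Icc a x, h (ξ x) ≤ h t := fun x hx => (hξ x hx).2.1
  have hanti : ∀ x y, a ≤ x → x ≤ y → h (ξ y) ≤ h (ξ x) := fun x y hx hxy =>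
    hmin y (hx.trans hxy) _ ⟨(hmem x hx).1, (hmem x hx).2.trans hxy⟩
  have hcase : ∀ x, a ≤ x → ξ x ≠ x → ξ x < x ∧ g (ξ x) ≤ F (ξ x) ∧ L ≤ V (ξ x) ∧ g x < F x ∧
      h (ξ x) < h x := by
    intro x hx hne
    have hlt : ξ x < x := lt_of_le_of_ne (hmem x hx).2 hne
    have hgF : ∀ t ∈ Ioc (ξ x) x, g t < F t ∧ max (F (ξ x)) (g (ξ x)) + L * (t - ξ x) ≤ F t := by
      intro t ht
      have h1 := hmin x hx t ⟨(hmem x hx).1.trans ht.1.le, ht.2⟩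
      simp only [hh] at h1
      have h2 := (hgK (ξ x) t ht.1.le).1
      have h3 := le_max_right (F (ξ x)) (g (ξ x))
      have h4 : (K : ℝ) * (t - ξ x) < L * (t - ξ x) :=
        mul_lt_mul_of_pos_right hL (sub_pos.2 ht.1)
      have h5 : g t < max (F t) (g t) := by linarith
      rcases le_total (F t) (g t) with h6 | h6
      · rw [max_eq_right h6] at h5; exact absurd h5 (lt_irrefl _)
      · rw [max_eq_left h6] at h5 h1
        exact ⟨h5, by linarith⟩
    have hge : g (ξ x) ≤ F (ξ x) := by
      have hFc : Continuous F := hFM.continuous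
      have h1 : Tendsto F (𝓝[>] (ξ x)) (𝓝 (F (ξ x))) := hFc.continuousAt.continuousWithinAt
      have h2 : Tendsto g (𝓝[>] (ξ x)) (𝓝 (g (ξ x))) :=
        hg.continuous.continuousAt.continuousWithinAt
      refine le_of_tendsto_of_tendsto h2 h1 ?_
      filter_upwards [Ioc_mem_nhdsGT hlt] with t ht using (hgF t ht).1.le
    refine ⟨hlt, hge, ?_, (hgF x ⟨hlt, le_rfl⟩).1, ?_⟩
    · refine le_deriv_of_forall_add_mul_le hlt (hF _) fun t ht => ?_
      have := (hgF t ht).2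
      rwa [max_eq_left hge] at this
    · by_contra hcon
      push Not at hcon
      have := (hξ x hx).2.2 x ⟨hx, le_rfl⟩ fun t ht => hcon.trans (hmin x hx t ht)
      linarith
  refine ⟨fun x => L * x + h (ξ x), ξ, N + ⟨L, hL0.le⟩, ?_, ?_, ?_, ?_, ?_, ?_⟩
  · intro x hx
    constructor
    · have h2 := (hgK (ξ x) x (hmem x hx.1).2).1
      have h3 := le_max_right (F (ξ x)) (g (ξ x))
      have h4 : (K : ℝ) * (x - ξ x) ≤ L * (x - ξ x) :=
        mul_le_mul_of_nonneg_right hL.le (sub_nonneg.2 (hmem x hx.1).2)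
      simp only [hh]; linarith
    · have := hmin x hx.1 x ⟨hx.1, le_rfl⟩
      simp only [hh] at this ⊢; linarith
  · intro x hx y hy hxy
    have := hanti x y hx.1 hxy
    linarith
  · have aux : ∀ x ∈ Icc a b, ∀ y ∈ Icc a b, x ≤ y →
        |(L * x + h (ξ x)) - (L * y + h (ξ y))| ≤ (N + L) * (y - x) := by
      intro x hx y hy hxy
      have h1 := hanti x y hx.1 hxy
      have h2 : h (ξ x) - h (ξ y) ≤ N * (y - x) := by
        rcases le_total (ξ y) x with h3 | h3
        · have := hmin x hx.1 (ξ y) ⟨(hmem y hy.1).1, h3⟩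
          have : 0 ≤ (N : ℝ) * (y - x) := mul_nonneg N.2 (sub_nonneg.2 hxy)
          linarith
        · have h4 := hmin x hx.1 x ⟨hx.1, le_rfl⟩
          have h5 := hhL.dist_le_mul x (ξ y)
          rw [Real.dist_eq, Real.dist_eq, abs_sub_comm x, abs_of_nonneg (sub_nonneg.2 h3)] at h5
          have h6 := le_abs_self (h x - h (ξ y))
          have h7 : (N : ℝ) * (ξ y - x) ≤ N * (y - x) :=
            mul_le_mul_of_nonneg_left (by linarith [(hmem y hy.1).2]) N.2
          linarith
      have h8 : 0 ≤ L * (y - x) := mul_nonneg hL0.le (sub_nonneg.2 hxy)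
      rw [abs_le]
      constructor <;> nlinarith
    refine LipschitzOnWith.of_dist_le_mul fun x hx y hy => ?_
    have hcoe : ((N + ⟨L, hL0.le⟩ : ℝ≥0) : ℝ) = N + L := rfl
    rw [hcoe]
    rcases le_total x y with hxy | hxy
    · rw [Real.dist_eq, Real.dist_eq, abs_sub_comm x, abs_of_nonneg (sub_nonneg.2 hxy)]
      exact aux x hx y hy hxy
    · rw [Real.dist_eq, Real.dist_eq, abs_of_nonneg (sub_nonneg.2 hxy), abs_sub_comm]
      exact aux y hy x hx hxy
  · intro x hx y hy hxy
    by_contra hcon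
    push Not at hcon
    have h1 : ξ y ≤ x := hcon.le.trans (hmem x hx.1).2
    have h2 := hmin x hx.1 (ξ y) ⟨(hmem y hy.1).1, h1⟩
    have h3 := (hξ y hy.1).2.2 (ξ x) ⟨(hmem x hx.1).1, (hmem x hx.1).2.trans hxy⟩
      fun t ht => h2.trans (hmin y hy.1 t ht)
    linarith
  · intro x hx
    exact ⟨(hmem x hx.1).1, (hmem x hx.1).2.trans hx.2⟩
  · intro x hx
    by_cases hne : ξ x = x
    · left
      refine ⟨hne, ?_⟩
      simp only [hne, hh]; ring
    · right
      obtain ⟨h1, h2, h3, h4, h5⟩ := hcase x hx.1 hne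
      refine ⟨h1, h2, h3, h4, fun hxo => ?_⟩
      have hev : ∀ᶠ t in 𝓝 x, ξ x < t ∧ h (ξ x) < h t :=
        (lt_mem_nhds h1).and (hhc.continuousAt.eventually (lt_mem_nhds h5))
      obtain ⟨l, r, hlr, hsub⟩ := mem_nhds_iff_exists_Ioo_subset.1 hev
      have hlin : HasDerivAt (fun t => L * t + h (ξ x)) L x := by
        simpa using ((hasDerivAt_id x).const_mul L).add_const (h (ξ x))
      refine hlin.congr_of_eventuallyEq ?_
      filter_upwards [Ioo_mem_nhds hlr.1 hlr.2] with t ht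
      have h6 := (hsub ht).1
      have hat : a ≤ t := (hmem x hx.1).1.trans h6.le
      have h7 : h (ξ t) ≤ h (ξ x) := hmin t hat _ ⟨(hmem x hx.1).1, h6.le⟩
      have h8 : h (ξ x) ≤ h (ξ t) := by
        rcases le_total (ξ t) x with h9 | h9
        · exact hmin x hx.1 _ ⟨(hmem t hat).1, h9⟩
        · exact (hsub ⟨hlr.1.trans_le h9, (hmem t hat).2.trans_lt ht.2⟩).2.le
      rw [le_antisymm h7 h8]

/-- The reflected version of `exists_upper_slope_envelope`, acting below the obstacle. -/
theorem exists_lower_slope_envelope {a b L : ℝ} {K M : ℝ≥0} {F V g : ℝ → ℝ}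
    (hF : ∀ x, HasDerivAt F (V x) x) (hFM : LipschitzWith M F) (hg : LipschitzWith K g)
    (hL : K < L) :
    ∃ (P ξ : ℝ → ℝ) (N : ℝ≥0), (∀ x ∈ Icc a b, P x ≤ g x ∧ min (F x) (g x) ≤ P x) ∧
      (∀ x ∈ Icc a b, ∀ y ∈ Icc a b, x ≤ y → P y - L * y ≤ P x - L * x) ∧
      LipschitzOnWith N P (Icc a b) ∧ MonotoneOn ξ (Icc a b) ∧ MapsTo ξ (Icc a b) (Icc a b) ∧
      ∀ x ∈ Icc a b, (ξ x = x ∧ P x = min (F x) (g x)) ∨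
        (x < ξ x ∧ F (ξ x) ≤ g (ξ x) ∧ L ≤ V (ξ x) ∧ F x < g x ∧
          (x ∈ Ioo a b → HasDerivAt P L x)) := by
  have hrefl : LipschitzWith 1 (fun x : ℝ => a + b - x) :=
    LipschitzWith.of_dist_le_mul fun x y => by
      rw [dist_sub_left]; simp
  have hd : ∀ x, HasDerivAt (fun x : ℝ => a + b - x) (-1) x := fun x => by
    simpa using (hasDerivAt_id x).const_sub (a + b)
  have hr : ∀ x ∈ Icc a b, a + b - x ∈ Icc a b := fun x hx =>
    ⟨by linarith [hx.2], by linarith [hx.1]⟩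
  have hF' : ∀ x, HasDerivAt (fun x => -F (a + b - x)) (V (a + b - x)) x := fun x => by
    exact ((hF (a + b - x)).comp x (hd x)).neg.congr_deriv (by ring)
  have hFM' : LipschitzWith M (fun x => -F (a + b - x)) := by
    have := (hFM.comp hrefl).neg
    rw [mul_one] at this
    exact this
  have hg' : LipschitzWith K (fun x => -g (a + b - x)) := by
    have := (hg.comp hrefl).neg
    rw [mul_one] at this
    exact this
  obtain ⟨P, ξ, N, h1, h2, h3, h4, h5, h6⟩ :=
    exists_upper_slope_envelope (a := a) (b := b) hF' hFM' hg' hL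
  refine ⟨fun x => -P (a + b - x), fun x => a + b - ξ (a + b - x), N, ?_, ?_, ?_, ?_, ?_, ?_⟩
  · intro x hx
    have := h1 _ (hr x hx)
    simp only [sub_sub_cancel, max_neg_neg] at this
    exact ⟨by linarith [this.1], by linarith [this.2]⟩
  · intro x hx y hy hxy
    have := h2 _ (hr y hy) _ (hr x hx) (by linarith)
    linarith
  · refine LipschitzOnWith.of_dist_le_mul fun x hx y hy => ?_
    have := h3.dist_le_mul _ (hr x hx) _ (hr y hy)
    rw [dist_neg_neg]
    rwa [dist_sub_left] at this
  · intro x hx y hy hxy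
    have := h4 (hr y hy) (hr x hx) (by linarith)
    simp only
    linarith
  · intro x hx
    exact hr _ (h5 (hr x hx))
  · intro x hx
    have := h6 _ (hr x hx)
    simp only [sub_sub_cancel, max_neg_neg] at this
    rcases this with ⟨h7, h8⟩ | ⟨h7, h8, h9, h10, h11⟩
    · left
      exact ⟨by linarith, by linarith⟩
    · right
      refine ⟨by linarith, by linarith, h9, by linarith, fun hxo => ?_⟩
      have := h11 ⟨by linarith [hxo.2], by linarith [hxo.1]⟩
      exact (this.comp x (hd x)).neg.congr_deriv (by ring)

theorem HasDerivAt.le_of_forall_sub_le {W : ℝ → ℝ} {x b d L : ℝ} (hxb : x < b)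
    (hW : HasDerivAt W d x) (h : ∀ y ∈ Ioc x b, W y - W x ≤ L * (y - x)) : d ≤ L := by
  have := le_deriv_of_forall_add_mul_le (L := -L) hxb hW.neg fun t ht => by
    have := h t ht
    simp only [Pi.neg_apply]
    linarith
  linarith

theorem HasDerivAt.eq_of_eqOn_of_right_accumulation {W F : ℝ → ℝ} {x d e : ℝ} {S : Set ℝ}
    (hW : HasDerivAt W d x) (hF : HasDerivAt F e x) (hx : W x = F x) (hS : EqOn W F S)
    (hacc : (𝓝[S ∩ Ioi x] x).NeBot) : d = e := by
  have h1 : Tendsto (slope W x) (𝓝[S ∩ Ioi x] x) (𝓝 d) :=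
    (hasDerivAt_iff_tendsto_slope.1 hW).mono_left
      (nhdsWithin_mono _ fun t ht => ne_of_gt ht.2)
  have h2 : Tendsto (slope F x) (𝓝[S ∩ Ioi x] x) (𝓝 e) :=
    (hasDerivAt_iff_tendsto_slope.1 hF).mono_left
      (nhdsWithin_mono _ fun t ht => ne_of_gt ht.2)
  refine tendsto_nhds_unique (h1.congr' ?_) h2
  filter_upwards [self_mem_nhdsWithin] with t ht
  rw [slope_def_field, slope_def_field, hS ht.1, hx]

/-- Limiting the upward slope of `F` by `L`, relative to the datum `g`. -/
theorem exists_slope_envelope {a b L : ℝ} {K M : ℝ≥0} {F V g : ℝ → ℝ} (hab : a < b)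
    (hF : ∀ x, HasDerivAt F (V x) x) (hFM : LipschitzWith M F) (hg : LipschitzWith K g)
    (hL : K < L) :
    ∃ (W ξ : ℝ → ℝ) (N : ℝ≥0), LipschitzWith N W ∧ MonotoneOn ξ (Icc a b) ∧
      MapsTo ξ (Icc a b) (Icc a b) ∧
      (∀ x ∈ Icc a b, ∀ y ∈ Icc a b, x ≤ y → W y - W x ≤ L * (y - x)) ∧
      (∀ x ∈ Icc a b, (F x - W x) ^ 2 ≤ (F x - g x) ^ 2 - (W x - g x) ^ 2) ∧
      W b ≤ F b ∧ F a ≤ W a ∧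
      ∀ᵐ x ∂(volume.restrict (Ioo a b)), HasDerivAt W (min (V (ξ x)) L) x ∧
        (min (V (ξ x)) L = V x ∨ min (V (ξ x)) L = L) := by
  obtain ⟨P, α, N₁, hP, hPs, hPl, hαm, hα, hPc⟩ :=
    exists_upper_slope_envelope (a := a) (b := b) hF hFM hg hL
  obtain ⟨Q, β, N₂, hQ, hQs, hQl, hβm, hβ, hQc⟩ :=
    exists_lower_slope_envelope (a := a) (b := b) hF hFM hg hL
  have hL0 : LipschitzOnWith (N₁ + N₂ + K) (fun x => P x + Q x - g x) (Icc a b) :=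
    LipschitzOnWith.of_dist_le_mul fun x hx y hy => by
      have h1 := hPl.dist_le_mul x hx y hy
      have h2 := hQl.dist_le_mul x hx y hy
      have h3 := hg.dist_le_mul x y
      push_cast
      rw [Real.dist_eq] at *
      have : P x + Q x - g x - (P y + Q y - g y) = (P x - P y) + (Q x - Q y) - (g x - g y) := by
        ring
      rw [this]
      have h4 := abs_sub ((P x - P y) + (Q x - Q y)) (g x - g y)
      have h5 := abs_add_le (P x - P y) (Q x - Q y)
      nlinarith
  obtain ⟨W, hWl, hW⟩ := hL0.extend_real
  have hPg : ∀ x ∈ Icc a b, F x ≤ g x → P x = g x := fun x hx h => by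
    have := hP x hx
    rw [max_eq_right h] at this
    exact le_antisymm this.2 this.1
  have hQg : ∀ x ∈ Icc a b, g x ≤ F x → Q x = g x := fun x hx h => by
    have := hQ x hx
    rw [min_eq_right h] at this
    exact le_antisymm this.1 this.2
  have hWP : ∀ x ∈ Icc a b, g x ≤ F x → W x = P x := fun x hx h => by
    rw [← hW hx]; simp only [hQg x hx h]; ring
  have hWQ : ∀ x ∈ Icc a b, F x ≤ g x → W x = Q x := fun x hx h => by
    rw [← hW hx]; simp only [hPg x hx h]; ring
  have hWF : ∀ x ∈ Icc a b, F x = g x → W x = F x := fun x hx h => by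
    rw [hWP x hx h.ge, hPg x hx h.le, h]
  have hFc : Continuous F := hFM.continuous
  have hslope : ∀ x ∈ Icc a b, ∀ y ∈ Icc a b, x ≤ y → W y - W x ≤ L * (y - x) := by
    have hup : ∀ x ∈ Icc a b, ∀ y ∈ Icc a b, x ≤ y → g x ≤ F x → g y ≤ F y →
        W y - W x ≤ L * (y - x) := fun x hx y hy hxy h1 h2 => by
      rw [hWP x hx h1, hWP y hy h2]; linarith [hPs x hx y hy hxy]
    have hdn : ∀ x ∈ Icc a b, ∀ y ∈ Icc a b, x ≤ y → F x ≤ g x → F y ≤ g y →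
        W y - W x ≤ L * (y - x) := fun x hx y hy hxy h1 h2 => by
      rw [hWQ x hx h1, hWQ y hy h2]; linarith [hQs x hx y hy hxy]
    intro x hx y hy hxy
    have hc : ContinuousOn (fun t => F t - g t) (Icc x y) :=
      (hFc.sub hg.continuous).continuousOn
    rcases le_total (g x) (F x) with h1 | h1 <;> rcases le_total (g y) (F y) with h2 | h2
    · exact hup x hx y hy hxy h1 h2
    · obtain ⟨z, hz, hz0⟩ := intermediate_value_Icc' hxy hc
        (show (0 : ℝ) ∈ Icc (F y - g y) (F x - g x) from ⟨by linarith, by linarith⟩)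
      have hz' : z ∈ Icc a b := ⟨hx.1.trans hz.1, hz.2.trans hy.2⟩
      simp only at hz0
      linarith [hup x hx z hz' hz.1 h1 (by linarith), hdn z hz' y hy hz.2 (by linarith) h2]
    · obtain ⟨z, hz, hz0⟩ := intermediate_value_Icc hxy hc
        (show (0 : ℝ) ∈ Icc (F x - g x) (F y - g y) from ⟨by linarith, by linarith⟩)
      have hz' : z ∈ Icc a b := ⟨hx.1.trans hz.1, hz.2.trans hy.2⟩
      simp only at hz0
      linarith [hdn x hx z hz' hz.1 h1 (by linarith), hup z hz' y hy hz.2 (by linarith) h2]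
    · exact hdn x hx y hy hxy h1 h2
  refine ⟨W, β ∘ α, _, hWl, fun x hx y hy hxy => hβm (hα hx) (hα hy) (hαm hx hy hxy),
    hβ.comp hα, hslope, ?_, ?_, ?_, ?_⟩
  · intro x hx
    rcases le_total (g x) (F x) with h1 | h1
    · have h2 := hP x hx
      rw [max_eq_left h1] at h2
      rw [hWP x hx h1]
      nlinarith [mul_nonneg (sub_nonneg.2 h2.1) (sub_nonneg.2 h2.2)]
    · have h2 := hQ x hx
      rw [min_eq_left h1] at h2
      rw [hWQ x hx h1]
      nlinarith [mul_nonneg (sub_nonneg.2 h2.1) (sub_nonneg.2 h2.2)]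
  · have hb := right_mem_Icc.2 hab.le
    rcases le_total (g b) (F b) with h1 | h1
    · rw [hWP b hb h1]; exact (hP b hb).2.trans (by rw [max_eq_left h1])
    · rw [hWQ b hb h1]
      rcases hQc b hb with h2 | h2
      · rw [h2.2]; exact min_le_left _ _
      · exact absurd h2.1 (not_lt.2 (hβ hb).2)
  · have ha := left_mem_Icc.2 hab.le
    rcases le_total (g a) (F a) with h1 | h1
    · rw [hWP a ha h1]
      rcases hPc a ha with h2 | h2
      · rw [h2.2]; exact le_max_left _ _
      · exact absurd h2.1 (not_lt.2 (hα ha).1)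
    · rw [hWQ a ha h1]; exact le_trans (by rw [min_eq_left h1]) (hQ a ha).2
  · set S : Set ℝ := {x | F x = g x} ∩ Icc a b with hS
    have hiso : ∀ᵐ x, x ∉ {x ∈ S | 𝓝[S ∩ Ioi x] x = ⊥} :=
      (countable_setOfPred_isolated_right_within (s := S)).ae_notMem _
    rw [ae_restrict_iff' measurableSet_Ioo]
    filter_upwards [hiso, hWl.ae_differentiableAt_real] with x hx hdiff hxo
    have hxI : x ∈ Icc a b := Ioo_subset_Icc_self hxo
    have hd := hdiff.hasDerivAt
    set d := deriv W x with hd_def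
    have hdL : d ≤ L := hd.le_of_forall_sub_le hxo.2 fun y hy =>
      hslope x hxI y ⟨hxI.1.trans hy.1.le, hy.2⟩ hy.1.le
    have hnear : ∀ᶠ y in 𝓝 x, y ∈ Icc a b := Icc_mem_nhds hxo.1 hxo.2
    rcases lt_trichotomy (F x) (g x) with hlt | heq | hgt
    · have hax : α x = x := by
        rcases hPc x hxI with h | h
        · exact h.1
        · exact absurd h.2.2.2.1 hlt.not_gt
      have hloc : ∀ᶠ y in 𝓝 x, F y < g y :=
        hFc.continuousAt.eventually_lt hg.continuous.continuousAt hlt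
      have hWQ' : W =ᶠ[𝓝 x] Q := by
        filter_upwards [hnear, hloc] with y hy h using hWQ y hy h.le
      simp only [Function.comp, hax]
      rcases hQc x hxI with h | h
      · rw [h.1]
        have hdV : V x = d := by
          have hmin : IsLocalMax (fun y => F y - W y) x := by
            filter_upwards [hnear, hloc] with y hy hy'
            have := (hQ y hy).2
            rw [min_eq_left hy'.le] at this
            rw [hWQ y hy hy'.le, hWQ x hxI hlt.le, h.2, min_eq_left hlt.le]
            linarith
          exact sub_eq_zero.1 (hmin.hasDerivAt_eq_zero ((hF x).sub hd))
        rw [hdV, min_eq_left hdL]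
        exact ⟨hd, Or.inl rfl⟩
      · rw [min_eq_right h.2.2.1]
        exact ⟨(h.2.2.2.2 hxo).congr_of_eventuallyEq hWQ', Or.inr rfl⟩
    · have hax : α x = x := by
        rcases hPc x hxI with h | h
        · exact h.1
        · exact absurd h.2.2.2.1 heq.not_gt
      have hbx : β x = x := by
        rcases hQc x hxI with h | h
        · exact h.1
        · exact absurd h.2.2.2.1 heq.not_lt
      simp only [Function.comp, hax, hbx]
      have hxS : x ∈ S := ⟨heq, hxI⟩
      have hdV : d = V x := hd.eq_of_eqOn_of_right_accumulation (hF x) (hWF x hxI heq)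
        (S := S) (fun y hy => hWF y hy.2 hy.1) ⟨fun h => hx ⟨hxS, h⟩⟩
      rw [← hdV, min_eq_left hdL]
      exact ⟨hd, Or.inl rfl⟩
    · have hloc : ∀ᶠ y in 𝓝 x, g y < F y :=
        hg.continuous.continuousAt.eventually_lt hFc.continuousAt hgt
      have hWP' : W =ᶠ[𝓝 x] P := by
        filter_upwards [hnear, hloc] with y hy h using hWP y hy h.le
      rcases hPc x hxI with h | h
      · have hbx : β x = x := by
          rcases hQc x hxI with h | h
          · exact h.1
          · exact absurd h.2.2.2.1 hgt.not_gt
        simp only [Function.comp, h.1, hbx]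
        have hdV : V x = d := by
          have hmin : IsLocalMin (fun y => F y - W y) x := by
            filter_upwards [hnear, hloc] with y hy hy'
            have := (hP y hy).2
            rw [max_eq_left hy'.le] at this
            rw [hWP y hy hy'.le, hWP x hxI hgt.le, h.2, max_eq_left hgt.le]
            linarith
          exact sub_eq_zero.1 (hmin.hasDerivAt_eq_zero ((hF x).sub hd))
        rw [hdV, min_eq_left hdL]
        exact ⟨hd, Or.inl rfl⟩
      · have hbx : β (α x) = α x := by
          rcases hQc _ (hα hxI) with h' | h'
          · exact h'.1
          · exact absurd h'.2.2.2.1 h.2.1.not_gt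
        simp only [Function.comp, hbx]
        rw [min_eq_right h.2.2.1]
        exact ⟨(h.2.2.2.2 hxo).congr_of_eventuallyEq hWP', Or.inr rfl⟩

theorem Monotone.exists_smooth_approx {ζ : ℝ → ℝ} (hζ : Monotone ζ) :
    ∃ η : ℕ → ℝ → ℝ, (∀ n, Monotone (η n)) ∧ (∀ n, ContDiff ℝ 1 (η n)) ∧
      ∀ᵐ x, Tendsto (fun n => η n x) atTop (𝓝 (ζ x)) := by
  have hloc : LocallyIntegrable ζ := hζ.locallyIntegrable
  have hpos : ∀ n : ℕ, (0 : ℝ) < 1 / ((n : ℝ) + 1) := fun n => Nat.one_div_pos_of_nat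
  set B : ℕ → ContDiffBump (0 : ℝ) := fun n =>
    ⟨1 / ((n : ℝ) + 1), 2 * (1 / ((n : ℝ) + 1)), hpos n, by linarith [hpos n]⟩ with hB
  refine ⟨fun n => MeasureTheory.convolution ((B n).normed volume) ζ
    (ContinuousLinearMap.lsmul ℝ ℝ) volume, fun n => ?_, fun n => ?_, ?_⟩
  · have hex : ∀ x, ConvolutionExistsAt ((B n).normed volume) ζ x
        (ContinuousLinearMap.lsmul ℝ ℝ) volume := fun x =>
      (B n).hasCompactSupport_normed.convolutionExists_left _ (B n).continuous_normed hloc x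
    intro x y hxy
    refine integral_mono (hex x) (hex y) fun t => ?_
    simp only [ContinuousLinearMap.lsmul_apply, smul_eq_mul]
    exact mul_le_mul_of_nonneg_left (hζ (by linarith)) ((B n).nonneg_normed t)
  · exact (B n).hasCompactSupport_normed.contDiff_convolution_left (n := 1) _
      (B n).contDiff_normed hloc
  · refine ContDiffBump.ae_convolution_tendsto_right_of_locallyIntegrable (K := 2) ?_ ?_ hloc
    · have := (tendsto_one_div_add_atTop_nhds_zero_nat (𝕜 := ℝ)).const_mul 2
      simpa [hB] using this
    · exact Eventually.of_forall fun n => le_rfl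

theorem deriv_eq_zero_of_const_outside {a b : ℝ} {φ : ℝ → ℝ} (ha : ∀ x ≤ a, φ x = φ a)
    (hb : ∀ x, b ≤ x → φ x = φ b) {x : ℝ} (hx : x ∉ Icc a b) : deriv φ x = 0 := by
  rcases lt_or_ge x a with h | h
  · have : φ =ᶠ[𝓝 x] fun _ => φ a := by
      filter_upwards [Iio_mem_nhds h] with y hy using ha y (le_of_lt hy)
    rw [this.deriv_eq, deriv_const]
  · have h' : b < x := by
      by_contra hc
      exact hx ⟨h, not_lt.1 hc⟩
    have : φ =ᶠ[𝓝 x] fun _ => φ b := by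
      filter_upwards [Ioi_mem_nhds h'] with y hy using hb y (le_of_lt hy)
    rw [this.deriv_eq, deriv_const]

theorem integrable_deriv_of_const_outside {a b : ℝ} (hab : a ≤ b) {φ : ℝ → ℝ}
    (hac : AbsolutelyContinuousOnInterval φ a b) (ha : ∀ x ≤ a, φ x = φ a)
    (hb : ∀ x, b ≤ x → φ x = φ b) : Integrable (deriv φ) := by
  have h1 : IntegrableOn (deriv φ) (Icc a b) := by
    rw [integrableOn_Icc_iff_integrableOn_Ioc]
    exact (intervalIntegrable_iff_integrableOn_Ioc_of_le hab).1 hac.intervalIntegrable_deriv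
  rw [← integrableOn_univ]
  refine h1.of_forall_sdiff_eq_zero MeasurableSet.univ fun x hx => ?_
  exact deriv_eq_zero_of_const_outside ha hb hx.2

/-- Approximation of a primitive of `φ ∘ ξ`, with `φ` absolutely continuous and `ξ` monotone,
by functions in `W^{2,1}` whose curvature term does not exceed that of `φ`. -/
theorem exists_W2pRep_approx {a b C B : ℝ} {N : ℝ≥0} (hab : a < b) {φ ξ W ψ g : ℝ → ℝ}
    (hφc : Continuous φ) (hφac : ∀ p r, AbsolutelyContinuousOnInterval φ p r)
    (ha : ∀ x ≤ a, φ x = φ a) (hb : ∀ x, b ≤ x → φ x = φ b) (hφB : ∀ x, |φ x| ≤ B)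
    (hξ : MonotoneOn ξ (Icc a b)) (hW : LipschitzWith N W)
    (hWd : ∀ᵐ x ∂(volume.restrict (Ioo a b)), HasDerivAt W (φ (ξ x)) x)
    (hψm : Measurable ψ) (hψ0 : ∀ t, 0 ≤ ψ t) (hψC : ∀ t, ψ t ≤ C) (hg : Continuous g) :
    ∃ f z q : ℕ → ℝ → ℝ, (∀ n, W2pRep 1 a b (f n) (z n) (q n)) ∧
      Tendsto (fun n => ∫ x in Ioo a b, |z n x|) atTop (𝓝 (∫ x in Ioo a b, |deriv W x|)) ∧
      Tendsto (fun n => ∫ x in Ioo a b, (f n x - g x) ^ 2) atTop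
        (𝓝 (∫ x in Ioo a b, (W x - g x) ^ 2)) ∧
      ∀ n, ∫ x in Ioo a b, ψ (z n x) * |q n x| ≤ ∫ x in Ioo a b, ψ (φ x) * |deriv φ x| := by
  set ζ : ℝ → ℝ := fun x => ξ (projIcc a b hab.le x) with hζdef
  have hζ : Monotone ζ := fun x y hxy =>
    hξ (projIcc a b hab.le x).2 (projIcc a b hab.le y).2 (monotone_projIcc hab.le hxy)
  have hζξ : ∀ x ∈ Icc a b, ζ x = ξ x := fun x hx => by
    simp only [hζdef, projIcc_of_mem hab.le hx]
  obtain ⟨η, hηm, hηd, hηt⟩ := hζ.exists_smooth_approx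
  have hηc : ∀ n, Continuous (η n) := fun n => (hηd n).continuous
  have hηh : ∀ n x, HasDerivAt (η n) (deriv (η n) x) x := fun n x =>
    ((hηd n).differentiable one_ne_zero x).hasDerivAt
  have hη0 : ∀ n x, 0 ≤ deriv (η n) x := fun n x => (hηm n).deriv_nonneg
  have hφ'i : Integrable (deriv φ) :=
    integrable_deriv_of_const_outside hab.le (hφac a b) ha hb
  set z : ℕ → ℝ → ℝ := fun n x => φ (η n x) with hz
  set q : ℕ → ℝ → ℝ := fun n x => deriv (η n) x * deriv φ (η n x) with hq
  set f : ℕ → ℝ → ℝ := fun n x => W a + ∫ t in a..x, z n t with hf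
  have hzc : ∀ n, Continuous (z n) := fun n => hφc.comp (hηc n)
  have hzB : ∀ n x, |z n x| ≤ B := fun n x => hφB _
  have hB0 : 0 ≤ B := (abs_nonneg _).trans (hφB 0)
  have hzt : ∀ᵐ x ∂(volume.restrict (Ioo a b)), Tendsto (fun n => z n x) atTop (𝓝 (deriv W x)) := by
    filter_upwards [ae_restrict_of_ae hηt, hWd, ae_restrict_mem measurableSet_Ioo] with x hx hx' hm
    rw [hx'.deriv, ← hζξ x (Ioo_subset_Icc_self hm)]
    exact (hφc.tendsto _).comp hx
  have hfd : ∀ n x, HasDerivAt (f n) (z n x) x := fun n x =>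
    ((hzc n).integral_hasStrictDerivAt a x).hasDerivAt.const_add _
  have hfc : ∀ n, Continuous (f n) := fun n =>
    continuous_iff_continuousAt.2 fun x => (hfd n x).continuousAt
  have hqi : ∀ n x y, x ≤ y → IntegrableOn (q n) (Icc x y) := fun n x y hxy => by
    have := (integrableOn_Icc_deriv_smul_iff_of_deriv_nonneg (f' := deriv (η n)) (g := deriv φ)
      (hηc n).continuousOn (fun x _ => hηh n x) (fun x _ => hη0 n x) hxy).2 hφ'i.integrableOn
    exact this
  have hcI : ∀ h : ℝ → ℝ, Continuous h → IntegrableOn h (Ioo a b) := fun h hh =>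
    hh.continuousOn.integrableOn_Icc.mono_set Ioo_subset_Icc_self
  have hzq : ∀ n x y, x ≤ y → z n y - z n x = ∫ t in x..y, q n t := fun n x y hxy => by
    have := integral_Icc_deriv_smul_of_deriv_nonneg (f' := deriv (η n)) (g := deriv φ)
      (hηc n).continuousOn (fun x _ => hηh n x) (fun x _ => hη0 n x) hxy
    rw [intervalIntegral.integral_of_le hxy, ← integral_Icc_eq_integral_Ioc]
    refine ((hφac (η n x) (η n y)).integral_deriv_eq_sub.symm.trans ?_).trans this.symm
    rw [intervalIntegral.integral_of_le (hηm n hxy), ← integral_Icc_eq_integral_Ioc]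
  refine ⟨f, z, q, fun n => ⟨fun x _ => hfd n x, fun x _ y _ => ?_, hcI _ (hfc n), hcI _ (hzc n),
    (hqi n a b hab.le).mono_set Ioo_subset_Icc_self, ?_⟩, ?_, ?_, fun n => ?_⟩
  · rcases le_total x y with h | h
    · exact hzq n x y h
    · rw [intervalIntegral.integral_symm, ← hzq n y x h]; ring
  · simp only [Real.rpow_one]
    exact ((hqi n a b hab.le).mono_set Ioo_subset_Icc_self).abs
  · refine tendsto_integral_of_dominated_convergence (fun _ => B)
      (fun n => (hzc n).abs.aestronglyMeasurable) (integrable_const _) (fun n => ?_) ?_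
    · filter_upwards with x
      rw [Real.norm_eq_abs, abs_abs]; exact hzB n x
    · filter_upwards [hzt] with x hx using hx.abs
  · have hfW : ∀ x ∈ Ioo a b, Tendsto (fun n => f n x) atTop (𝓝 (W x)) := fun x hx => by
      have h1 : W x = W a + ∫ t in a..x, deriv W t := by
        rw [(hW.lipschitzOnWith (s := uIcc a x)).absolutelyContinuousOnInterval.integral_deriv_eq_sub]
        ring
      rw [h1]
      refine tendsto_const_nhds.add ?_
      refine intervalIntegral.tendsto_integral_filter_of_dominated_convergence (fun _ => B)
        (Eventually.of_forall fun n => (hzc n).aestronglyMeasurable)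
        (Eventually.of_forall fun n => Eventually.of_forall fun t _ => hzB n t)
        intervalIntegrable_const ?_
      rw [uIoc_of_le hx.1.le, ← ae_restrict_iff' measurableSet_Ioc]
      exact ae_restrict_of_ae_restrict_of_subset
        (Ioc_subset_Ioo_right hx.2) hzt
    obtain ⟨G, hG⟩ := isCompact_Icc.exists_bound_of_continuousOn (s := Icc a b) hg.continuousOn
    refine tendsto_integral_of_dominated_convergence (fun _ => (|W a| + B * (b - a) + G) ^ 2)
      (fun n => (((hfc n).sub hg).pow 2).aestronglyMeasurable) (integrable_const _) (fun n => ?_) ?_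
    · filter_upwards [ae_restrict_mem measurableSet_Ioo] with x hx
      rw [Real.norm_eq_abs, abs_pow]
      have h1 : |∫ t in a..x, z n t| ≤ B * (b - a) := by
        have := intervalIntegral.norm_integral_le_of_norm_le_const (a := a) (b := x) (f := z n)
          (C := B) fun t _ => hzB n t
        rw [Real.norm_eq_abs, abs_of_pos (sub_pos.2 hx.1)] at this
        exact this.trans (mul_le_mul_of_nonneg_left (by linarith [hx.2]) hB0)
      have h2 := hG x (Ioo_subset_Icc_self hx)
      rw [Real.norm_eq_abs] at h2
      have h3 : |f n x - g x| ≤ |W a| + B * (b - a) + G := by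
        refine (abs_sub _ _).trans (add_le_add ((abs_add_le _ _).trans ?_) h2)
        linarith
      exact pow_le_pow_left₀ (abs_nonneg _) h3 2
    · filter_upwards [ae_restrict_mem measurableSet_Ioo] with x hx
      exact ((hfW x hx).sub_const _).pow 2
  · set k : ℝ → ℝ := fun x => ψ (φ x) * |deriv φ x| with hk
    have hki : Integrable k := by
      refine (hφ'i.abs.const_mul C).mono'
        ((hψm.comp hφc.measurable).mul (measurable_deriv φ).abs).aestronglyMeasurable ?_
      filter_upwards with x
      rw [Real.norm_eq_abs, hk, abs_mul, abs_abs, abs_of_nonneg (hψ0 _)]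
      exact mul_le_mul_of_nonneg_right (hψC _) (abs_nonneg _)
    have hk0 : ∀ x, 0 ≤ k x := fun x => mul_nonneg (hψ0 _) (abs_nonneg _)
    have h1 := integral_Icc_deriv_smul_of_deriv_nonneg (f' := deriv (η n)) (g := k)
      (hηc n).continuousOn (fun x _ => hηh n x) (fun x _ => hη0 n x) hab.le
    have h2 : ∫ x in Ioo a b, ψ (z n x) * |q n x| = ∫ u in Icc (η n a) (η n b), k u := by
      rw [← h1, integral_Icc_eq_integral_Ioo]
      refine integral_congr_ae (Eventually.of_forall fun x => ?_)
      simp only [hq, hk, hz, abs_mul, abs_of_nonneg (hη0 n x), smul_eq_mul]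
      ring
    have h3 : ∫ x in Icc a b, k x = ∫ x, k x :=
      setIntegral_eq_integral_of_forall_compl_eq_zero fun x hx => by
        simp [hk, deriv_eq_zero_of_const_outside ha hb hx]
    rw [h2, ← integral_Icc_eq_integral_Ioo (f := k), h3]
    exact setIntegral_le_integral hki (Eventually.of_forall hk0)

theorem LipschitzWith.comp_absolutelyContinuousOnInterval {Θ V : ℝ → ℝ} {C : ℝ≥0} {p r : ℝ}
    (hΘ : LipschitzWith C Θ) (hV : AbsolutelyContinuousOnInterval V p r) :
    AbsolutelyContinuousOnInterval (fun x => Θ (V x)) p r := by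
  have h := hV.const_mul (C : ℝ)
  refine squeeze_zero (fun t => Finset.sum_nonneg fun i _ => dist_nonneg) (fun t => ?_) h
  refine Finset.sum_le_sum fun i _ => ?_
  refine (hΘ.dist_le_mul _ _).trans (le_of_eq ?_)
  rw [Real.dist_eq, Real.dist_eq, ← mul_sub, abs_mul, NNReal.abs_eq]

theorem exists_bound_of_const_outside {a b : ℝ} {V : ℝ → ℝ} (hab : a ≤ b) (hV : Continuous V)
    (ha : ∀ x ≤ a, V x = V a) (hb : ∀ x, b ≤ x → V x = V b) : ∃ B : ℝ≥0, ∀ x, |V x| ≤ B := by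
  obtain ⟨B, hB⟩ := isCompact_Icc.exists_bound_of_continuousOn (s := Icc a b) hV.continuousOn
  have hB0 : 0 ≤ B := (norm_nonneg _).trans (hB a (left_mem_Icc.2 hab))
  refine ⟨⟨B, hB0⟩, fun x => ?_⟩
  rcases le_total x a with h | h
  · rw [ha x h]; exact hB a (left_mem_Icc.2 hab)
  · rcases le_total b x with h' | h'
    · rw [hb x h']; exact hB b (right_mem_Icc.2 hab)
    · exact hB x ⟨h, h'⟩

/-- The energy `∫|f'| + ∫ψ(f')|f''| + λ∫(f-g)²` of a Sobolev function `f` with first and second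
derivatives `v` and `q`. -/
def sobolevEnergy (ψ g : ℝ → ℝ) (lam a b : ℝ) (f v q : ℝ → ℝ) : ℝ :=
  (∫ x in Ioo a b, |v x|) + (∫ x in Ioo a b, ψ (v x) * |q x|) +
    lam * ∫ x in Ioo a b, (f x - g x) ^ 2

theorem integrableOn_psi_mul_abs {ψ v q : ℝ → ℝ} {s : Set ℝ} (hψ : PsiHyp ψ)
    (hv : AEMeasurable v (volume.restrict s)) (hq : IntegrableOn q s) :
    IntegrableOn (fun x => ψ (v x) * |q x|) s := by
  obtain ⟨C, hC⟩ := hψ.bounded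
  refine (hq.abs.const_mul C).mono'
    ((hψ.measurable.comp_aemeasurable hv).mul hq.aemeasurable.abs).aestronglyMeasurable ?_
  filter_upwards with x
  rw [Real.norm_eq_abs, abs_mul, abs_abs, abs_of_pos (hψ.pos _)]
  exact mul_le_mul_of_nonneg_right (hC _) (abs_nonneg _)

theorem integral_abs_deriv_le {a b L : ℝ} {N : ℝ≥0} (hab : a < b) (hL : 0 < L)
    {F V W : ℝ → ℝ} (hF : ∀ x, HasDerivAt F (V x) x) (hV : Continuous V)
    (hW : LipschitzWith N W) (hb : W b ≤ F b) (ha : F a ≤ W a)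
    (h : ∀ᵐ x ∂(volume.restrict (Ioo a b)), deriv W x = V x ∨ deriv W x = L) :
    ∫ x in Ioo a b, |deriv W x| ≤ ∫ x in Ioo a b, |V x| := by
  have hac := (hW.lipschitzOnWith (s := uIcc a b)).absolutelyContinuousOnInterval
  have hWi : IntegrableOn (deriv W) (Ioo a b) :=
    ((intervalIntegrable_iff_integrableOn_Ioc_of_le hab.le).1
      hac.intervalIntegrable_deriv).mono_set Ioo_subset_Ioc_self
  have hVi : IntegrableOn V (Ioo a b) :=
    hV.continuousOn.integrableOn_Icc.mono_set Ioo_subset_Icc_self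
  have h1 : ∫ x in Ioo a b, deriv W x = W b - W a := by
    rw [← hac.integral_deriv_eq_sub, intervalIntegral.integral_of_le hab.le,
      integral_Ioc_eq_integral_Ioo]
  have h2 : ∫ x in Ioo a b, V x = F b - F a := by
    rw [← intervalIntegral.integral_eq_sub_of_hasDerivAt (fun x _ => hF x)
      (hV.intervalIntegrable a b), intervalIntegral.integral_of_le hab.le,
      integral_Ioc_eq_integral_Ioo]
  have h3 : ∫ x in Ioo a b, (|deriv W x| - deriv W x) ≤ ∫ x in Ioo a b, (|V x| - V x) := by
    refine integral_mono_ae (hWi.abs.sub hWi) (hVi.abs.sub hVi) ?_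
    filter_upwards [h] with x hx
    rcases hx with hx | hx
    · rw [hx]
    · simp only [hx, abs_of_pos hL, sub_self]
      linarith [le_abs_self (V x)]
  rw [integral_sub hWi.abs hWi, integral_sub hVi.abs hVi] at h3
  linarith

theorem integral_psi_truncation_le {a b L : ℝ} {ψ V q : ℝ → ℝ} (hψ : PsiHyp ψ) (hV : Continuous V)
    (hVq : ∀ᵐ x ∂(volume.restrict (Ioo a b)), HasDerivAt V (q x) x)
    (hq : IntegrableOn q (Ioo a b)) :
    ∫ x in Ioo a b, ψ (min (V x) L) * |deriv (fun y => min (V y) L) x| ≤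
      ∫ x in Ioo a b, ψ (V x) * |q x| := by
  refine integral_mono_of_nonneg
    (Eventually.of_forall fun x => mul_nonneg (hψ.pos _).le (abs_nonneg _))
    (integrableOn_psi_mul_abs hψ hV.aemeasurable hq) ?_
  filter_upwards [hVq] with x hx
  rcases lt_or_ge (V x) L with h | h
  · have : (fun y => min (V y) L) =ᶠ[𝓝 x] V := by
      filter_upwards [hV.continuousAt.eventually_lt continuousAt_const h] with y hy
        using min_eq_left hy.le
    rw [this.deriv_eq, hx.deriv, min_eq_left h.le]
  · have : IsLocalMax (fun y => min (V y) L) x :=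
      Eventually.of_forall fun y => by simp only [min_eq_right h, min_le_right]
    rw [this.deriv_eq_zero, abs_zero, mul_zero]
    exact mul_nonneg (hψ.pos _).le (abs_nonneg _)

/-- Limiting the upward slope lowers the energy of a Sobolev function by at least
`λ‖f - W‖²`, up to an arbitrarily small error. -/
theorem exists_energy_improvement {a b lam L : ℝ} {K : ℝ≥0} {ψ g f v q : ℝ → ℝ} (hab : a < b)
    (hlam : 0 < lam) (hψ : PsiHyp ψ) (hg : LipschitzWith K g) (hL : K < L)
    (h : W2pRep 1 a b f v q) :
    ∃ W : ℝ → ℝ, Continuous W ∧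
      (∀ x ∈ Icc a b, ∀ y ∈ Icc a b, x ≤ y → W y - W x ≤ L * (y - x)) ∧
      ∀ ε > 0, ∃ f' v' q', W2pRep 1 a b f' v' q' ∧
        sobolevEnergy ψ g lam a b f' v' q' ≤
          sobolevEnergy ψ g lam a b f v q - lam * (∫ x in Ioo a b, (f x - W x) ^ 2) + ε := by
  obtain ⟨F, V, hFf, hVv, hF, hVc, hVa, hVb, hVac, hVq⟩ := h.exists_global hab
  obtain ⟨M, hM⟩ := exists_bound_of_const_outside hab.le hVc hVa hVb
  have hL0 : 0 < L := lt_of_le_of_lt K.2 hL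
  have hFM : LipschitzWith M F :=
    lipschitzWith_of_nnnorm_deriv_le (fun x => (hF x).differentiableAt) fun x => by
      rw [(hF x).deriv]; exact hM x
  obtain ⟨W, ξ, N, hW, hξ, -, hs, hfid, hWb, hWa, hWd⟩ :=
    exists_slope_envelope hab hF hFM hg hL
  refine ⟨W, hW.continuous, hs, fun ε hε => ?_⟩
  obtain ⟨C, hC⟩ := hψ.bounded
  have hmin : LipschitzWith 1 (fun x : ℝ => min x L) := by
    simpa using! LipschitzWith.id.min_const L
  obtain ⟨fn, zn, qn, hrep, ht1, ht2, hle⟩ := exists_W2pRep_approx (C := C) (B := max M L) (N := N)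
    (φ := fun x => min (V x) L) (ξ := ξ) (W := W) (ψ := ψ) (g := g) hab
    (hVc.min continuous_const) (fun p r => hmin.comp_absolutelyContinuousOnInterval (hVac p r))
    (fun x hx => by simp only [hVa x hx]) (fun x hx => by simp only [hVb x hx])
    (fun x => abs_le.2 ⟨le_min (by linarith [neg_abs_le (V x), hM x, le_max_left (M : ℝ) L])
      (by linarith [le_max_right (M : ℝ) L]), (min_le_right _ _).trans (le_max_right _ _)⟩)
    hξ hW (hWd.mono fun x hx => hx.1) hψ.measurable (fun t => (hψ.pos t).le) hC hg.continuous
  have hTV := integral_abs_deriv_le hab hL0 hF hVc hW hWb hWa (hWd.mono fun x hx => by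
    rw [hx.1.deriv]; exact hx.2)
  have hcurv := integral_psi_truncation_le (L := L) hψ hVc hVq h.2.2.2.2.1
  have hcont : ∀ h : ℝ → ℝ, Continuous h → IntegrableOn h (Ioo a b) := fun h hh =>
    hh.continuousOn.integrableOn_Icc.mono_set Ioo_subset_Icc_self
  have hFc := hFM.continuous
  have hWc := hW.continuous
  have hgc := hg.continuous
  have hfi : ∫ x in Ioo a b, (F x - W x) ^ 2 ≤
      (∫ x in Ioo a b, (F x - g x) ^ 2) - ∫ x in Ioo a b, (W x - g x) ^ 2 := by
    rw [← integral_sub (hcont _ (by fun_prop)) (hcont _ (by fun_prop))]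
    exact setIntegral_mono_on (hcont _ (by fun_prop)) (hcont _ (by fun_prop)) measurableSet_Ioo
      fun x hx => hfid x (Ioo_subset_Icc_self hx)
  have e1 : ∫ x in Ioo a b, |v x| = ∫ x in Ioo a b, |V x| :=
    setIntegral_congr_fun measurableSet_Ioo fun x hx => by simp only [hVv x hx]
  have e2 : ∫ x in Ioo a b, ψ (v x) * |q x| = ∫ x in Ioo a b, ψ (V x) * |q x| :=
    setIntegral_congr_fun measurableSet_Ioo fun x hx => by simp only [hVv x hx]
  have e3 : ∫ x in Ioo a b, (f x - g x) ^ 2 = ∫ x in Ioo a b, (F x - g x) ^ 2 :=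
    setIntegral_congr_fun measurableSet_Ioo fun x hx => by simp only [hFf x hx]
  have e4 : ∫ x in Ioo a b, (f x - W x) ^ 2 = ∫ x in Ioo a b, (F x - W x) ^ 2 :=
    setIntegral_congr_fun measurableSet_Ioo fun x hx => by simp only [hFf x hx]
  have hlim := ht1.add (ht2.const_mul lam)
  obtain ⟨n, hn⟩ := (hlim.eventually (gt_mem_nhds (lt_add_of_pos_right _ hε))).exists
  refine ⟨fn n, zn n, qn n, hrep n, ?_⟩
  unfold sobolevEnergy
  rw [e1, e2, e3, e4]
  have := hle n
  have := mul_le_mul_of_nonneg_left hfi hlam.le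
  linarith

theorem IsDerivMeasures.congr_ae {a b : ℝ} {u w : ℝ → ℝ} {μp μn : Measure ℝ}
    (h : IsDerivMeasures a b u μp μn) (huw : u =ᵐ[volume.restrict (Ioo a b)] w) :
    IsDerivMeasures a b w μp μn := by
  obtain ⟨h1, h2, h3, h4, h5, h6, h7⟩ := h
  refine ⟨h1.congr huw, h2, h3, h4, h5, h6, fun φ hφ hs => ?_⟩
  rw [← h7 φ hφ hs]
  refine integral_congr_ae ?_
  filter_upwards [huw] with x hx
  rw [hx]

theorem bounded_of_tsupport_subset_Ioo {a b : ℝ} {φ : ℝ → ℝ} (hφ : Continuous φ)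
    (hs : tsupport φ ⊆ Ioo a b) : ∃ C, ∀ x, |φ x| ≤ C := by
  have hc : HasCompactSupport φ :=
    isCompact_Icc.of_isClosed_subset (isClosed_tsupport φ) (hs.trans Ioo_subset_Icc_self)
  obtain ⟨C, hC⟩ := hc.exists_bound_of_continuous hφ
  exact ⟨C, hC⟩

theorem setIntegral_Ioo_eq_integral_of_tsupport {a b : ℝ} {φ D : ℝ → ℝ}
    (hs : tsupport φ ⊆ Ioo a b) : ∫ x in Ioo a b, D x * φ x = ∫ x, D x * φ x :=
  setIntegral_eq_integral_of_forall_compl_eq_zero fun x hx => by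
    rw [image_eq_zero_of_notMem_tsupport fun h => hx (hs h), mul_zero]

theorem integral_withDensity_ofReal {D φ : ℝ → ℝ} (hD : Measurable D) :
    ∫ x, φ x ∂(volume.withDensity fun x => ENNReal.ofReal (D x)) = ∫ x, max (D x) 0 * φ x := by
  rw [integral_withDensity_eq_integral_toReal_smul hD.ennreal_ofReal
    (Eventually.of_forall fun _ => ENNReal.ofReal_lt_top)]
  simp only [ENNReal.toReal_ofReal', smul_eq_mul]

theorem integral_withDensity_neg_sub {D φ : ℝ → ℝ} {C : ℝ} (hD : Measurable D)
    (hDi : Integrable D) (hφ : Continuous φ) (hC : ∀ x, |φ x| ≤ C) :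
    (∫ x, φ x ∂(volume.withDensity fun x => ENNReal.ofReal (-D x))) -
      ∫ x, φ x ∂(volume.withDensity fun x => ENNReal.ofReal (D x)) = -∫ x, D x * φ x := by
  rw [integral_withDensity_ofReal hD, integral_withDensity_ofReal (D := fun x => -D x) hD.neg, ← integral_sub,
    ← integral_neg]
  · refine integral_congr_ae (Eventually.of_forall fun x => ?_)
    simp only
    rw [← sub_mul, ← neg_mul]
    congr 1
    rcases le_total 0 (D x) with h | h
    · rw [max_eq_right (by linarith), max_eq_left h]; ring
    · rw [max_eq_left (by linarith), max_eq_right h]; ring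
  · exact hDi.neg.pos_part.mul_bdd hφ.aestronglyMeasurable (Eventually.of_forall hC)
  · exact hDi.pos_part.mul_bdd hφ.aestronglyMeasurable (Eventually.of_forall hC)

/-- The derivative of an absolutely continuous function is its pointwise derivative. -/
theorem isDerivMeasures_of_absolutelyContinuous {a b : ℝ} (hab : a < b) {U D : ℝ → ℝ}
    (hU : AbsolutelyContinuousOnInterval U a b) (hD : Measurable D) (hDi : Integrable D)
    (hD0 : ∀ x ∉ Ioo a b, D x = 0) (hUD : ∀ᵐ x ∂(volume.restrict (Ioo a b)), deriv U x = D x) :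
    IsDerivMeasures a b U (volume.withDensity fun x => ENNReal.ofReal (D x))
      (volume.withDensity fun x => ENNReal.ofReal (-D x)) := by
  have hUi : IntegrableOn U (Ioo a b) := by
    have := hU.continuousOn
    rw [uIcc_of_le hab.le] at this
    exact this.integrableOn_Icc.mono_set Ioo_subset_Icc_self
  have hnull : ∀ E : ℝ → ℝ, (∀ x ∉ Ioo a b, E x = 0) →
      (volume.withDensity fun x => ENNReal.ofReal (E x)) (Ioo a b)ᶜ = 0 := fun E hE => by
    rw [withDensity_apply _ measurableSet_Ioo.compl]
    refine (setLIntegral_congr_fun measurableSet_Ioo.compl fun x hx => ?_).trans lintegral_zero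
    simp only [hE x hx, ENNReal.ofReal_zero]
  refine ⟨hUi, isFiniteMeasure_withDensity_ofReal hDi.2,
    isFiniteMeasure_withDensity_ofReal hDi.neg.2, withDensity_ofReal_mutuallySingular hD,
    hnull D hD0, hnull (fun x => -D x) fun x hx => by rw [hD0 x hx, neg_zero],
    fun φ hφ hs => ?_⟩
  obtain ⟨C, hC⟩ := bounded_of_tsupport_subset_Ioo hφ.continuous hs
  rw [integral_withDensity_neg_sub hD hDi hφ.continuous hC,
    ← setIntegral_Ioo_eq_integral_of_tsupport hs]
  have hφac : AbsolutelyContinuousOnInterval φ a b :=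
    hφ.contDiffOn.absolutelyContinuousOnInterval
  have h1 := hU.integral_mul_deriv_eq_deriv_mul hφac
  rw [image_eq_zero_of_notMem_tsupport fun h => lt_irrefl a (hs h).1,
    image_eq_zero_of_notMem_tsupport fun h => lt_irrefl b (hs h).2,
    intervalIntegral.integral_of_le hab.le, intervalIntegral.integral_of_le hab.le,
    integral_Ioc_eq_integral_Ioo, integral_Ioc_eq_integral_Ioo] at h1
  rw [h1]
  simp only [mul_zero, sub_zero, zero_sub, neg_inj]
  refine integral_congr_ae ?_
  filter_upwards [hUD] with x hx
  rw [hx]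

theorem uaD_withDensity {D : ℝ → ℝ} (hD : Measurable D) :
    uaD (volume.withDensity fun x => ENNReal.ofReal (D x))
      (volume.withDensity fun x => ENNReal.ofReal (-D x)) =ᵐ[volume] D := by
  filter_upwards [Measure.rnDeriv_withDensity volume hD.ennreal_ofReal,
    Measure.rnDeriv_withDensity volume hD.neg.ennreal_ofReal] with x h1 h2
  simp only [Pi.neg_apply] at h2
  rw [uaD, h1, h2, ENNReal.toReal_ofReal', ENNReal.toReal_ofReal']
  rcases le_total 0 (D x) with h | h
  · rw [max_eq_right (by linarith : -D x ≤ 0), max_eq_left h]; ring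
  · rw [max_eq_left (by linarith : 0 ≤ -D x), max_eq_right h]; ring

theorem PsiHyp.psi1_sub {ψ : ℝ → ℝ} (hψ : PsiHyp ψ) (s t : ℝ) :
    Psi1 ψ t - Psi1 ψ s = ∫ r in s..t, ψ r :=
  intervalIntegral.integral_Iic_sub_Iic hψ.integrable.integrableOn hψ.integrable.integrableOn

theorem PsiHyp.lipschitzWith_psi1 {ψ : ℝ → ℝ} (hψ : PsiHyp ψ) :
    ∃ C : ℝ≥0, LipschitzWith C (Psi1 ψ) := by
  obtain ⟨C, hC⟩ := hψ.bounded
  refine ⟨⟨C, (hψ.pos 0).le.trans (hC 0)⟩, LipschitzWith.of_dist_le_mul fun s t => ?_⟩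
  rw [dist_comm, Real.dist_eq, hψ.psi1_sub, dist_comm, Real.dist_eq]
  have : ∀ r ∈ uIoc s t, ‖ψ r‖ ≤ C := fun r _ => by
    rw [Real.norm_eq_abs, abs_of_pos (hψ.pos r)]
    exact hC r
  exact intervalIntegral.norm_integral_le_of_norm_le_const this

theorem W2pRep.exists_memX1 {a b : ℝ} (hab : a < b) {ψ f v q : ℝ → ℝ} (hψ : PsiHyp ψ)
    (h : W2pRep 1 a b f v q) : ∃ μp μn, MemX1 ψ a b f μp μn := by
  obtain ⟨F, V, hFf, hVv, hF, hVc, hVa, hVb, hVac, hVq⟩ := h.exists_global hab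
  obtain ⟨M, hM⟩ := exists_bound_of_const_outside hab.le hVc hVa hVb
  have hFM : LipschitzWith M F :=
    lipschitzWith_of_nnnorm_deriv_le (fun x => (hF x).differentiableAt) fun x => by
      rw [(hF x).deriv]; exact hM x
  have hind : ∀ G : ℝ → ℝ, ∀ x ∉ Ioo a b, (Ioo a b).indicator G x = 0 := fun G x hx =>
    indicator_of_notMem hx G
  have hae : ∀ G : ℝ → ℝ, ∀ᵐ x ∂(volume.restrict (Ioo a b)), G x = (Ioo a b).indicator G x :=
    fun G => by
      filter_upwards [ae_restrict_mem measurableSet_Ioo] with x hx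
      rw [indicator_of_mem hx]
  have hDm : Measurable ((Ioo a b).indicator V) := hVc.measurable.indicator measurableSet_Ioo
  have hDi : Integrable ((Ioo a b).indicator V) :=
    (integrable_indicator_iff measurableSet_Ioo).2
      (hVc.continuousOn.integrableOn_Icc.mono_set Ioo_subset_Icc_self)
  have h1 := isDerivMeasures_of_absolutelyContinuous hab
    (hFM.lipschitzOnWith.absolutelyContinuousOnInterval) hDm hDi (hind V) (by
      filter_upwards [hae V] with x hx
      rw [(hF x).deriv, hx])
  obtain ⟨C, hC⟩ := hψ.lipschitzWith_psi1
  have hPac := hC.comp_absolutelyContinuousOnInterval (hVac a b)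
  have hEi : Integrable ((Ioo a b).indicator (deriv fun x => Psi1 ψ (V x))) :=
    (integrable_indicator_iff measurableSet_Ioo).2
      (((intervalIntegrable_iff_integrableOn_Ioc_of_le hab.le).1
        hPac.intervalIntegrable_deriv).mono_set Ioo_subset_Ioc_self)
  have h2 := isDerivMeasures_of_absolutelyContinuous hab hPac
    ((measurable_deriv _).indicator measurableSet_Ioo) hEi (hind _) (hae _)
  refine ⟨_, _, h1.congr_ae ?_, ⟨_, _, h2.congr_ae ?_⟩, ?_, ?_⟩
  · filter_upwards [ae_restrict_mem measurableSet_Ioo] with x hx using hFf x hx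
  · filter_upwards [ae_restrict_of_ae (uaD_withDensity hDm), hae V] with x hx hx'
    rw [hx, ← hx']
  · simp [cantorPos, Measure.singularPart_withDensity]
  · simp [cantorNeg, Measure.singularPart_withDensity]

theorem W2pRep.FpRel_le {a b : ℝ} {ψ f v q : ℝ → ℝ} (h : W2pRep 1 a b f v q) :
    FpRel ψ 1 a b f ≤
      ENNReal.ofReal ((∫ x in Ioo a b, |v x|) + ∫ x in Ioo a b, ψ (v x) * |q x|) := by
  have h0 : TendstoL1 a b (fun _ => f) f := ⟨fun _ => h.2.2.1, h.2.2.1, by simp⟩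
  refine (iInf₂_le (fun _ => f) h0).trans ?_
  rw [liminf_const]
  refine (iInf_le_of_le v (iInf₂_le q h)).trans ?_
  simp only [Real.rpow_one, le_refl]

theorem W2pRep.neg {a b : ℝ} {f v q : ℝ → ℝ} (h : W2pRep 1 a b f v q) :
    W2pRep 1 a b (fun x => -f x) (fun x => -v x) (fun x => -q x) := by
  obtain ⟨h1, h2, h3, h4, h5, h6⟩ := h
  refine ⟨fun x hx => (h1 x hx).fun_neg, fun x hx y hy => ?_, h3.neg, h4.neg, h5.neg, ?_⟩
  · rw [intervalIntegral.integral_neg, ← h2 x hx y hy]; ring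
  · simpa only [abs_neg] using h6

theorem PsiHyp.comp_neg {ψ : ℝ → ℝ} (hψ : PsiHyp ψ) : PsiHyp fun t => ψ (-t) := by
  refine ⟨hψ.measurable.comp measurable_neg, fun t => hψ.pos _, ?_, hψ.integrable.comp_neg,
    fun K hK => ?_⟩
  · obtain ⟨C, hC⟩ := hψ.bounded
    exact ⟨C, fun t => hC _⟩
  · obtain ⟨δ, hδ, h⟩ := hψ.inf_pos (-K) hK.neg
    exact ⟨δ, hδ, fun t ht => h _ (by simpa using ht)⟩

theorem sobolevEnergy_neg (ψ g : ℝ → ℝ) (lam a b : ℝ) (f v q : ℝ → ℝ) :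
    sobolevEnergy (fun t => ψ (-t)) (fun x => -g x) lam a b (fun x => -f x) (fun x => -v x)
      (fun x => -q x) = sobolevEnergy ψ g lam a b f v q := by
  simp only [sobolevEnergy, abs_neg, neg_neg]
  congr 2
  refine integral_congr_ae (Eventually.of_forall fun x => ?_)
  simp only
  ring

/-- Limiting the downward slope instead of the upward one in `exists_energy_improvement`. -/
theorem exists_energy_improvement_neg {a b lam L : ℝ} {K : ℝ≥0} {ψ g f v q : ℝ → ℝ} (hab : a < b)
    (hlam : 0 < lam) (hψ : PsiHyp ψ) (hg : LipschitzWith K g) (hL : K < L)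
    (h : W2pRep 1 a b f v q) :
    ∃ W : ℝ → ℝ, Continuous W ∧
      (∀ x ∈ Icc a b, ∀ y ∈ Icc a b, x ≤ y → W x - W y ≤ L * (y - x)) ∧
      ∀ ε > 0, ∃ f' v' q', W2pRep 1 a b f' v' q' ∧
        sobolevEnergy ψ g lam a b f' v' q' ≤
          sobolevEnergy ψ g lam a b f v q - lam * (∫ x in Ioo a b, (f x - W x) ^ 2) + ε := by
  obtain ⟨W, hW, hs, himp⟩ := exists_energy_improvement hab hlam hψ.comp_neg
    (show LipschitzWith K fun x => -g x from hg.neg) hL h.neg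
  refine ⟨fun x => -W x, hW.neg, fun x hx y hy hxy => by linarith [hs x hx y hy hxy],
    fun ε hε => ?_⟩
  obtain ⟨f', v', q', hr, hle⟩ := himp ε hε
  refine ⟨_, _, _, hr.neg, ?_⟩
  rw [sobolevEnergy_neg ψ g] at hle
  rw [← sobolevEnergy_neg]
  simp only [neg_neg]
  refine hle.trans (le_of_eq ?_)
  congr 3
  refine integral_congr_ae (Eventually.of_forall fun x => ?_)
  simp only
  ring

theorem exists_seq_ae_tendsto_zero {α : Type*} [MeasurableSpace α] {μ : Measure α}
    {h : ℕ → α → ℝ} (hi : ∀ n, Integrable (h n) μ)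
    (ht : Tendsto (fun n => ∫ x, |h n x| ∂μ) atTop (𝓝 0)) :
    ∃ ns : ℕ → ℕ, StrictMono ns ∧
      ∀ᵐ x ∂μ, Tendsto (fun k => h (ns k) x) atTop (𝓝 0) := by
  have h1 : Tendsto (fun n => eLpNorm (h n - 0) 1 μ) atTop (𝓝 0) := by
    have := ENNReal.tendsto_ofReal ht
    rw [ENNReal.ofReal_zero] at this
    refine this.congr fun n => ?_
    rw [sub_zero, eLpNorm_one_eq_lintegral_enorm,
      ← ofReal_integral_norm_eq_lintegral_enorm (hi n)]
    rfl
  exact (tendstoInMeasure_of_tendsto_eLpNorm one_ne_zero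
    (fun n => (hi n).aestronglyMeasurable) aestronglyMeasurable_const h1).exists_seq_tendsto_ae

theorem exists_W2pRep_near {a b ε : ℝ} {ψ u : ℝ → ℝ} (hfin : FpRel ψ 1 a b u ≠ ⊤) (hε : 0 < ε) :
    ∃ f v q, W2pRep 1 a b f v q ∧ ∫ x in Ioo a b, |f x - u x| < ε ∧
      (∫ x in Ioo a b, |v x|) + ∫ x in Ioo a b, ψ (v x) * |q x| ≤
        (FpRel ψ 1 a b u).toReal + ε := by
  have hε' : ENNReal.ofReal ε ≠ 0 := by simpa using hε
  have h1 : FpRel ψ 1 a b u < FpRel ψ 1 a b u + ENNReal.ofReal ε := ENNReal.lt_add_right hfin hε'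
  obtain ⟨U, hU⟩ := iInf_lt_iff.1 (show (⨅ (U : ℕ → ℝ → ℝ) (_ : TendstoL1 a b U u),
    liminf (fun k => Fp ψ 1 a b (U k)) atTop) < FpRel ψ 1 a b u + ENNReal.ofReal ε from h1)
  obtain ⟨hUt, hUl⟩ := iInf_lt_iff.1 hU
  obtain ⟨k, hk1, hk2⟩ := ((frequently_lt_of_liminf_lt (by isBoundedDefault) hUl).and_eventually
    (hUt.2.2.eventually (gt_mem_nhds hε))).exists
  obtain ⟨v, hv⟩ := iInf_lt_iff.1 hk1
  obtain ⟨q, hq⟩ := iInf_lt_iff.1 hv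
  obtain ⟨hr, hlt⟩ := iInf_lt_iff.1 hq
  refine ⟨U k, v, q, hr, hk2, ?_⟩
  have h2 := hlt.le
  rw [← ENNReal.ofReal_toReal hfin, ← ENNReal.ofReal_add ENNReal.toReal_nonneg hε.le,
    ENNReal.ofReal_le_ofReal_iff (by positivity)] at h2
  simpa only [Real.rpow_one] using h2

theorem W2pRep.abs_le {a b : ℝ} (hab : a < b) {f v q : ℝ → ℝ} (h : W2pRep 1 a b f v q) {x : ℝ}
    (hx : x ∈ Ioo a b) :
    |f x| ≤ (∫ t in Ioo a b, |f t|) / (b - a) + ∫ t in Ioo a b, |v t| := by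
  have hba : 0 < b - a := sub_pos.2 hab
  set T := ∫ t in Ioo a b, |v t| with hT
  have h1 : ∀ y ∈ Ioo a b, |f x - f y| ≤ T := fun y hy => by
    have hsub : uIcc y x ⊆ Ioo a b := ordConnected_Ioo.uIcc_subset hy hx
    have hintegrable : IntervalIntegrable v volume y x :=
      intervalIntegrable_iff.2 (h.2.2.2.1.mono_set (uIoc_subset_uIcc.trans hsub))
    rw [← intervalIntegral.integral_eq_sub_of_hasDerivAt (fun t ht => h.1 t (hsub ht)) hintegrable]
    have h2 : |∫ t in y..x, v t| ≤ ∫ t in uIoc y x, |v t| := by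
      simpa only [Real.norm_eq_abs] using
        intervalIntegral.norm_integral_le_integral_norm_uIoc (f := v) (a := y) (b := x)
          (μ := volume)
    refine h2.trans ?_
    exact setIntegral_mono_set h.2.2.2.1.abs (Eventually.of_forall fun t => abs_nonneg _)
      (uIoc_subset_uIcc.trans hsub).eventuallyLE
  have h2 : ∫ _ in Ioo a b, (|f x| - T) ≤ ∫ t in Ioo a b, |f t| := by
    refine setIntegral_mono_on (integrable_const _) h.2.2.1.abs measurableSet_Ioo fun y hy => ?_
    have := h1 y hy
    have := abs_sub_abs_le_abs_sub (f x) (f y)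
    linarith
  rw [setIntegral_const, Measure.real, Real.volume_Ioo, ENNReal.toReal_ofReal hba.le,
    smul_eq_mul] at h2
  have : |f x| - T ≤ (∫ t in Ioo a b, |f t|) / (b - a) := by
    rw [le_div_iff₀ hba]; linarith
  linarith

/-- If every Sobolev function can be moved into a class `R` with an energy gain controlling the
distance moved, then a minimizer of the relaxed energy is an a.e. limit of functions in `R`. -/
theorem exists_seq_tendsto_of_energy_improvement {a b lam : ℝ} (hab : a < b) (hlam : 0 < lam)
    {ψ g u : ℝ → ℝ} (hψ : PsiHyp ψ) (hg : Continuous g) (hu : IntegrableOn u (Ioo a b))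
    (hmin : ∀ f v q, W2pRep 1 a b f v q →
      FpRel ψ 1 a b u + ENNReal.ofReal (lam * ∫ x in Ioo a b, (u x - g x) ^ 2) ≤
        ENNReal.ofReal (sobolevEnergy ψ g lam a b f v q))
    {R : (ℝ → ℝ) → Prop}
    (himp : ∀ f v q, W2pRep 1 a b f v q → ∃ W : ℝ → ℝ, Continuous W ∧ R W ∧
      ∀ ε > 0, ∃ f' v' q', W2pRep 1 a b f' v' q' ∧
        sobolevEnergy ψ g lam a b f' v' q' ≤
          sobolevEnergy ψ g lam a b f v q - lam * (∫ x in Ioo a b, (f x - W x) ^ 2) + ε) :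
    ∃ W : ℕ → ℝ → ℝ, (∀ n, R (W n)) ∧
      ∀ᵐ x ∂(volume.restrict (Ioo a b)), Tendsto (fun n => W n x) atTop (𝓝 (u x)) := by
  have hfin : FpRel ψ 1 a b u ≠ ⊤ := by
    have h0 : W2pRep 1 a b (fun _ => 0) (fun _ => 0) (fun _ => 0) :=
      ⟨fun x _ => hasDerivAt_const x 0, by simp, by simp, by simp, by simp, by simp⟩
    exact ((le_self_add.trans (hmin _ _ _ h0)).trans_lt ENNReal.ofReal_lt_top).ne
  set A := (FpRel ψ 1 a b u).toReal with hA
  set I := ∫ x in Ioo a b, (u x - g x) ^ 2 with hI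
  have hI0 : 0 ≤ I := integral_nonneg fun x => sq_nonneg _
  have hA0 : 0 ≤ A := ENNReal.toReal_nonneg
  have hJ0 : ∀ f v q, 0 ≤ sobolevEnergy ψ g lam a b f v q := fun f v q => by
    refine add_nonneg (add_nonneg (integral_nonneg fun x => abs_nonneg _)
      (integral_nonneg fun x => mul_nonneg (hψ.pos _).le (abs_nonneg _)))
      (mul_nonneg hlam.le (integral_nonneg fun x => sq_nonneg _))
  have hmin' : ∀ f v q, W2pRep 1 a b f v q → A + lam * I ≤ sobolevEnergy ψ g lam a b f v q :=
    fun f v q h => by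
      have := hmin f v q h
      rwa [← ENNReal.ofReal_toReal hfin, ← ENNReal.ofReal_add hA0 (mul_nonneg hlam.le hI0),
        ENNReal.ofReal_le_ofReal_iff (hJ0 f v q)] at this
  have hpos : ∀ n : ℕ, (0 : ℝ) < 1 / ((n : ℝ) + 1) := fun n => Nat.one_div_pos_of_nat
  have hle1 : ∀ n : ℕ, 1 / ((n : ℝ) + 1) ≤ 1 := fun n => by
    rw [div_le_one (by positivity)]; linarith [n.cast_nonneg (α := ℝ)]
  have hto0 : Tendsto (fun n : ℕ => 1 / ((n : ℝ) + 1)) atTop (𝓝 0) :=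
    tendsto_one_div_add_atTop_nhds_zero_nat
  choose f v q hr hfu hE using fun n : ℕ => exists_W2pRep_near hfin (hpos n)
  choose W hWc hWR hWi using fun n => himp _ _ _ (hr n)
  have hfi : ∀ n, IntegrableOn (f n) (Ioo a b) := fun n => (hr n).2.2.1
  have hsubi : ∀ n, IntegrableOn (fun x => f n x - u x) (Ioo a b) := fun n => (hfi n).sub hu
  obtain ⟨ns, hns, hfae⟩ := exists_seq_ae_tendsto_zero hsubi
    (squeeze_zero (fun n => integral_nonneg fun x => abs_nonneg _) (fun n => (hfu n).le) hto0)
  obtain ⟨G, hG⟩ := isCompact_Icc.exists_bound_of_continuousOn (s := Icc a b) hg.continuousOn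
  set B := ((∫ x in Ioo a b, |u x|) + 1) / (b - a) + (A + 1) with hB
  have hba : 0 < b - a := sub_pos.2 hab
  have hfB : ∀ n, ∀ x ∈ Ioo a b, |f n x| ≤ B := fun n x hx => by
    refine ((hr n).abs_le hab hx).trans (add_le_add ?_ ?_)
    · refine div_le_div_of_nonneg_right ?_ hba.le
      have : ∫ t in Ioo a b, |f n t| ≤ ∫ t in Ioo a b, (|f n t - u t| + |u t|) :=
        integral_mono (hfi n).abs ((hsubi n).abs.add hu.abs) fun t => by
          have := abs_add_le (f n t - u t) (u t)
          rwa [sub_add_cancel] at this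
      rw [integral_add (hsubi n).abs hu.abs] at this
      linarith [hfu n, hle1 n]
    · have : 0 ≤ ∫ x in Ioo a b, ψ (v n x) * |q n x| :=
        integral_nonneg fun x => mul_nonneg (hψ.pos _).le (abs_nonneg _)
      linarith [hE n, hle1 n]
  have hfc : ∀ n, ContinuousOn (f n) (Ioo a b) := fun n x hx =>
    ((hr n).1 x hx).continuousAt.continuousWithinAt
  have hfg : Tendsto (fun k => ∫ x in Ioo a b, (f (ns k) x - g x) ^ 2) atTop (𝓝 I) := by
    refine tendsto_integral_of_dominated_convergence (fun _ => (B + G) ^ 2)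
      (fun k => (((hfi _).aestronglyMeasurable.sub hg.aestronglyMeasurable).pow 2))
      (integrable_const _) (fun k => ?_) ?_
    · filter_upwards [ae_restrict_mem measurableSet_Ioo] with x hx
      rw [Real.norm_eq_abs, abs_pow]
      refine pow_le_pow_left₀ (abs_nonneg _) ((abs_sub _ _).trans (add_le_add (hfB _ x hx) ?_)) 2
      exact hG x (Ioo_subset_Icc_self hx)
    · filter_upwards [hfae] with x hx
      have : Tendsto (fun k => f (ns k) x) atTop (𝓝 (u x)) := by
        simpa using hx.add_const (u x)
      exact (this.sub_const _).pow 2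
  have hfWi : ∀ n, IntegrableOn (fun x => (f n x - W n x) ^ 2) (Ioo a b) := fun n => by
    obtain ⟨H, hH⟩ := isCompact_Icc.exists_bound_of_continuousOn (s := Icc a b)
      (hWc n).continuousOn
    refine (integrable_const ((B + H) ^ 2)).mono'
      (((hfi n).aestronglyMeasurable.sub (hWc n).aestronglyMeasurable).pow 2) ?_
    filter_upwards [ae_restrict_mem measurableSet_Ioo] with x hx
    rw [Real.norm_eq_abs, abs_pow]
    refine pow_le_pow_left₀ (abs_nonneg _) ((abs_sub _ _).trans (add_le_add (hfB _ x hx) ?_)) 2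
    exact hH x (Ioo_subset_Icc_self hx)
  have hgain : ∀ n, ∫ x in Ioo a b, (f n x - W n x) ^ 2 ≤
      ((∫ x in Ioo a b, (f n x - g x) ^ 2) - I) + 2 / lam * (1 / ((n : ℝ) + 1)) := fun n => by
    obtain ⟨f', v', q', hr', hle⟩ := hWi n _ (hpos n)
    have h1 := (hmin' _ _ _ hr').trans hle
    have h2 := hE n
    unfold sobolevEnergy at h1
    have h3 : lam * (∫ x in Ioo a b, (f n x - W n x) ^ 2) ≤
        lam * (((∫ x in Ioo a b, (f n x - g x) ^ 2) - I) + 2 / lam * (1 / ((n : ℝ) + 1))) := by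
      have : lam * (2 / lam * (1 / ((n : ℝ) + 1))) = 2 * (1 / ((n : ℝ) + 1)) := by
        field_simp
      rw [mul_add, this, mul_sub]
      linarith
    exact le_of_mul_le_mul_left h3 hlam
  have hlim : Tendsto (fun k => ∫ x in Ioo a b, |(f (ns k) x - W (ns k) x) ^ 2|) atTop (𝓝 0) := by
    have h1 := (hfg.sub_const I).add
      ((hto0.comp hns.tendsto_atTop).const_mul (2 / lam))
    simp only [sub_self, mul_zero, add_zero] at h1
    refine squeeze_zero (fun k => integral_nonneg fun x => abs_nonneg _) (fun k => ?_) h1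
    simp only [abs_pow, sq_abs]
    exact hgain (ns k)
  obtain ⟨ms, hms, hWae⟩ := exists_seq_ae_tendsto_zero (fun k => hfWi (ns k)) hlim
  refine ⟨fun k => W (ns (ms k)), fun k => hWR _, ?_⟩
  filter_upwards [hfae, hWae] with x h1 h2
  have h3 : Tendsto (fun k => f (ns (ms k)) x - W (ns (ms k)) x) atTop (𝓝 0) := by
    have := (continuous_abs.tendsto _).comp ((Real.continuous_sqrt.tendsto _).comp h2)
    simp only [Real.sqrt_zero, abs_zero] at this
    refine (tendsto_zero_iff_abs_tendsto_zero _).2 (this.congr fun k => ?_)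
    simp only [Function.comp, Real.sqrt_sq_eq_abs, abs_abs]
  have h4 := (h1.comp hms.tendsto_atTop).sub h3
  simpa using h4.add_const (u x)

theorem exists_lipschitz_of_relaxed_min {a b lam : ℝ} (hab : a < b) (hlam : 0 < lam) {K : ℝ≥0}
    {ψ g u : ℝ → ℝ} (hψ : PsiHyp ψ) (hg : LipschitzWith K g) (hu : IntegrableOn u (Ioo a b))
    (hmin : ∀ f v q, W2pRep 1 a b f v q →
      FpRel ψ 1 a b u + ENNReal.ofReal (lam * ∫ x in Ioo a b, (u x - g x) ^ 2) ≤
        ENNReal.ofReal (sobolevEnergy ψ g lam a b f v q)) :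
    ∃ ubar : ℝ → ℝ, LipschitzWith (K + 1) ubar ∧
      ∀ᵐ x ∂(volume.restrict (Ioo a b)), ubar x = u x := by
  have hL : (K : ℝ) < (K + 1 : ℝ≥0) := by push_cast; linarith
  obtain ⟨P, hP, hPu⟩ := exists_seq_tendsto_of_energy_improvement hab hlam hψ hg.continuous hu hmin
    (fun f v q h => exists_energy_improvement hab hlam hψ hg hL h)
  obtain ⟨Q, hQ, hQu⟩ := exists_seq_tendsto_of_energy_improvement hab hlam hψ hg.continuous hu hmin
    (fun f v q h => exists_energy_improvement_neg hab hlam hψ hg hL h)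
  set S := {x | x ∈ Ioo a b ∧ Tendsto (fun n => P n x) atTop (𝓝 (u x)) ∧
    Tendsto (fun n => Q n x) atTop (𝓝 (u x))} with hS
  have hord : ∀ x ∈ S, ∀ y ∈ S, x ≤ y → |u y - u x| ≤ (K + 1 : ℝ≥0) * (y - x) := by
    intro x hx y hy hxy
    refine _root_.abs_le.2 ⟨?_, ?_⟩
    · have := le_of_tendsto' (hx.2.2.sub hy.2.2) fun n =>
        hQ n x (Ioo_subset_Icc_self hx.1) y (Ioo_subset_Icc_self hy.1) hxy
      linarith
    · exact le_of_tendsto' (hy.2.1.sub hx.2.1) fun n =>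
        hP n x (Ioo_subset_Icc_self hx.1) y (Ioo_subset_Icc_self hy.1) hxy
  have hlip : LipschitzOnWith (K + 1) u S := LipschitzOnWith.of_dist_le_mul fun x hx y hy => by
    rw [Real.dist_eq, Real.dist_eq]
    rcases le_total x y with h | h
    · rw [abs_sub_comm, abs_sub_comm x, abs_of_nonneg (sub_nonneg.2 h)]
      exact hord x hx y hy h
    · rw [abs_of_nonneg (sub_nonneg.2 h)]
      exact hord y hy x hx h
  obtain ⟨ubar, hub, heq⟩ := hlip.extend_real
  refine ⟨ubar, hub, ?_⟩
  filter_upwards [ae_restrict_mem measurableSet_Ioo, hPu, hQu] with x h1 h2 h3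
  exact (heq ⟨h1, h2, h3⟩).symm

/-- Du Bois-Reymond's lemma on a bounded interval. -/
theorem exists_ae_eq_const_of_integral_mul_deriv_eq_zero {a b : ℝ} (hab : a < b) {d : ℝ → ℝ}
    (hd : IntegrableOn d (Ioo a b))
    (h : ∀ φ : ℝ → ℝ, ContDiff ℝ 1 φ → tsupport φ ⊆ Ioo a b →
      ∫ x in Ioo a b, d x * deriv φ x = 0) :
    ∃ c, ∀ᵐ x ∂(volume.restrict (Ioo a b)), d x = c := by
  let β : ContDiffBump ((a + b) / 2) := ⟨(b - a) / 8, (b - a) / 4, by linarith, by linarith⟩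
  set η : ℝ → ℝ := β.normed volume with hη
  have hηc : ContDiff ℝ 1 η := β.contDiff_normed
  have hηK : IsCompact (tsupport η) := β.hasCompactSupport_normed
  have hηs : tsupport η ⊆ Ioo a b := by
    rw [hη, β.tsupport_normed_eq, Real.closedBall_eq_Icc]
    refine Icc_subset_Ioo ?_ ?_ <;> simp only [β] <;> linarith
  have hη1 : ∫ x, η x = 1 := β.integral_normed
  have hmulint : ∀ θ : ℝ → ℝ, Continuous θ → tsupport θ ⊆ Ioo a b →
      IntegrableOn (fun x => d x * θ x) (Ioo a b) := fun θ hθ hs => by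
    obtain ⟨C, hC⟩ := bounded_of_tsupport_subset_Ioo hθ hs
    exact Integrable.mul_bdd (c := C) hd hθ.aestronglyMeasurable (Eventually.of_forall hC)
  have hkey : ∀ θ : ℝ → ℝ, ContDiff ℝ 1 θ → tsupport θ ⊆ Ioo a b →
      ∫ x in Ioo a b, d x * θ x = (∫ x in Ioo a b, d x * η x) * ∫ x, θ x := by
    intro θ hθ hθs
    have hθK : IsCompact (tsupport θ) :=
      isCompact_Icc.of_isClosed_subset (isClosed_tsupport θ) (hθs.trans Ioo_subset_Icc_self)
    set m := ∫ x, θ x with hm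
    set χ : ℝ → ℝ := fun x => θ x - m * η x with hχ
    have hχc : Continuous χ := hθ.continuous.sub (continuous_const.mul hηc.continuous)
    set K := insert ((a + b) / 2) (tsupport θ ∪ tsupport η) with hK
    have hKc : IsCompact K := (hθK.union hηK).insert _
    have hKs : K ⊆ Ioo a b :=
      insert_subset ⟨by linarith, by linarith⟩ (union_subset hθs hηs)
    obtain ⟨l, hl, hl'⟩ := hKc.exists_isLeast ⟨_, mem_insert _ _⟩
    obtain ⟨r, hr, hr'⟩ := hKc.exists_isGreatest ⟨_, mem_insert _ _⟩
    have hχ0 : ∀ x ∉ K, χ x = 0 := fun x hx => by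
      simp only [hK, mem_insert_iff, mem_union, not_or] at hx
      simp only [hχ]
      rw [image_eq_zero_of_notMem_tsupport hx.2.1, image_eq_zero_of_notMem_tsupport hx.2.2]
      ring
    have hχi : ∫ x, χ x = 0 := by
      simp only [hχ]
      rw [integral_sub (hθ.continuous.integrable_of_hasCompactSupport hθK)
        ((hηc.continuous.integrable_of_hasCompactSupport hηK).const_mul m),
        integral_const_mul, hη1]
      simp [hm]
    set φ : ℝ → ℝ := fun x => ∫ t in a..x, χ t with hφ
    have hφd : ∀ x, HasDerivAt φ (χ x) x := fun x =>
      intervalIntegral.integral_hasDerivAt_right (hχc.intervalIntegrable _ _)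
        (hχc.stronglyMeasurableAtFilter _ _) hχc.continuousAt
    have hφd' : deriv φ = χ := funext fun x => (hφd x).deriv
    have hφc : ContDiff ℝ 1 φ := contDiff_one_iff_deriv.2
      ⟨fun x => (hφd x).differentiableAt, hφd' ▸ hχc⟩
    have hφs : tsupport φ ⊆ Ioo a b := by
      refine Subset.trans (closure_minimal (t := Icc l r) ?_ isClosed_Icc)
        (Icc_subset_Ioo (hKs hl).1 (hKs hr).2)
      intro x hx
      by_contra hxI
      refine hx ?_
      simp only [mem_Icc, not_and_or, not_le] at hxI
      rcases hxI with hxl | hxr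
      · simp only [hφ]
        refine intervalIntegral.integral_zero_ae (Eventually.of_forall fun t ht => hχ0 t fun htK => ?_)
        have h1 := hl' htK
        have h2 := (uIoc_subset_uIcc ht).2
        have : max a x < l := max_lt (hKs hl).1 hxl
        exact absurd (h2.trans_lt this) (not_lt.2 h1)
      · simp only [hφ]
        rw [intervalIntegral.integral_eq_integral_of_support_subset, hχi]
        intro t ht
        have htK : t ∈ K := by
          by_contra hc
          exact ht (hχ0 t hc)
        exact ⟨(hKs htK).1, (hr' htK).trans hxr.le⟩
    have h1 := h φ hφc hφs
    rw [hφd'] at h1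
    have h2 : ∫ x in Ioo a b, d x * χ x =
        (∫ x in Ioo a b, d x * θ x) - m * ∫ x in Ioo a b, d x * η x := by
      rw [← integral_const_mul, ← integral_sub (hmulint θ hθ.continuous hθs)
        ((hmulint η hηc.continuous hηs).const_mul m)]
      refine integral_congr_ae (Eventually.of_forall fun x => ?_)
      simp only [hχ]
      ring
    rw [h2] at h1
    linarith
  refine ⟨∫ x in Ioo a b, d x * η x, ?_⟩
  set c := ∫ x in Ioo a b, d x * η x with hc
  have hintegrable : IntegrableOn (fun x => d x - c) (Ioo a b) := hd.sub (integrable_const c)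
  have := isOpen_Ioo.ae_eq_zero_of_integral_contDiff_smul_eq_zero
    (hintegrable.locallyIntegrableOn) (fun θ hθ hθc hθs => by
      have hθ1 : ContDiff ℝ 1 θ := hθ.of_le (by exact_mod_cast le_top)
      rw [← setIntegral_eq_integral_of_forall_compl_eq_zero (s := Ioo a b) fun x hx => by
        rw [image_eq_zero_of_notMem_tsupport fun h => hx (hθs h), zero_smul]]
      have h1 : ∫ x in Ioo a b, θ x • (d x - c) =
          (∫ x in Ioo a b, d x * θ x) - c * ∫ x in Ioo a b, θ x := by
        rw [← integral_const_mul, ← integral_sub (hmulint θ hθ1.continuous hθs)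
          ((hθ1.continuous.integrable_of_hasCompactSupport hθc).integrableOn.const_mul c)]
        refine integral_congr_ae (Eventually.of_forall fun x => ?_)
        simp only [smul_eq_mul]
        ring
      rw [h1, hkey θ hθ1 hθs, setIntegral_eq_integral_of_forall_compl_eq_zero fun x hx =>
        image_eq_zero_of_notMem_tsupport fun h => hx (hθs h), sub_self])
  rw [ae_restrict_iff' measurableSet_Ioo]
  filter_upwards [this] with x hx hxI
  exact sub_eq_zero.1 (hx hxI)

theorem integral_eq_neg_integral_measureReal_Iio_mul_deriv {ν : Measure ℝ} [IsFiniteMeasure ν]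
    {φ : ℝ → ℝ} (hφ : ContDiff ℝ 1 φ) (hc : HasCompactSupport φ) :
    ∫ x, φ x ∂ν = -∫ x, ν.real (Iio x) * deriv φ x := by
  have hd : Continuous (deriv φ) := hφ.continuous_deriv le_rfl
  have hdi : Integrable (deriv φ) := hd.integrable_of_hasCompactSupport hc.deriv
  set S : Set (ℝ × ℝ) := {p | p.1 < p.2} with hS
  have hSm : MeasurableSet S := measurableSet_lt measurable_fst measurable_snd
  have hintegrable : Integrable (S.indicator fun p : ℝ × ℝ => deriv φ p.2) (ν.prod volume) :=
    (hdi.comp_snd ν).indicator hSm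
  have h1 : ∀ t, φ t = -∫ x, S.indicator (fun p : ℝ × ℝ => deriv φ p.2) (t, x) := fun t => by
    have : (fun x => S.indicator (fun p : ℝ × ℝ => deriv φ p.2) (t, x)) =
        (Ioi t).indicator (deriv φ) := by
      ext x
      simp only [indicator, hS, mem_ofPred_eq, mem_Ioi]
    rw [this, integral_indicator measurableSet_Ioi, hc.integral_Ioi_deriv_eq hφ, neg_neg]
  have h2 : ∀ x, ∫ t, S.indicator (fun p : ℝ × ℝ => deriv φ p.2) (t, x) ∂ν =
      ν.real (Iio x) * deriv φ x := fun x => by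
    have : (fun t => S.indicator (fun p : ℝ × ℝ => deriv φ p.2) (t, x)) =
        (Iio x).indicator fun _ => deriv φ x := by
      ext t
      simp only [indicator, hS, mem_ofPred_eq, mem_Iio]
    rw [this, integral_indicator_const _ measurableSet_Iio, smul_eq_mul]
  calc ∫ t, φ t ∂ν = ∫ t, -(∫ x, S.indicator (fun p : ℝ × ℝ => deriv φ p.2) (t, x)) ∂ν :=
        integral_congr_ae (Eventually.of_forall h1)
    _ = -∫ x, ν.real (Iio x) * deriv φ x := by
        rw [integral_neg, integral_integral_swap
          (f := fun t x => S.indicator (fun p : ℝ × ℝ => deriv φ p.2) (t, x)) hintegrable]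
        simp only [h2]

theorem monotone_measureReal_Iio (ν : Measure ℝ) [IsFiniteMeasure ν] :
    Monotone fun x => ν.real (Iio x) :=
  fun _ _ h => measureReal_mono (Iio_subset_Iio h)

/-- A function of bounded variation is a.e. the difference of the distribution functions of the
parts of its derivative, up to a constant. -/
theorem IsDerivMeasures.exists_ae_eq {a b : ℝ} (hab : a < b) {w : ℝ → ℝ} {μp μn : Measure ℝ}
    (h : IsDerivMeasures a b w μp μn) :
    ∃ c, ∀ᵐ x ∂(volume.restrict (Ioo a b)),
      w x = c + (μp.real (Iio x) - μn.real (Iio x)) := by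
  obtain ⟨h1, h2, h3, -, -, -, h7⟩ := h
  have hFi : ∀ (ν : Measure ℝ) [IsFiniteMeasure ν],
      IntegrableOn (fun x => ν.real (Iio x)) (Ioo a b) := fun ν _ =>
    Measure.integrableOn_of_bounded (M := ν.real univ) (by simp)
      (monotone_measureReal_Iio ν).measurable.aestronglyMeasurable
      (Eventually.of_forall fun x => by
        rw [Real.norm_of_nonneg measureReal_nonneg]
        exact measureReal_mono (subset_univ _))
  obtain ⟨c, hc⟩ := exists_ae_eq_const_of_integral_mul_deriv_eq_zero hab
    (d := fun x => w x - (μp.real (Iio x) - μn.real (Iio x)))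
    (h1.sub ((hFi μp).sub (hFi μn))) (fun φ hφ hs => by
      have hcs : HasCompactSupport φ :=
        isCompact_Icc.of_isClosed_subset (isClosed_tsupport φ) (hs.trans Ioo_subset_Icc_self)
      have hd : Continuous (deriv φ) := hφ.continuous_deriv le_rfl
      have hds : tsupport (deriv φ) ⊆ Ioo a b := tsupport_deriv_subset.trans hs
      obtain ⟨C, hC⟩ := bounded_of_tsupport_subset_Ioo hd hds
      have hm : ∀ D : ℝ → ℝ, IntegrableOn D (Ioo a b) →
          IntegrableOn (fun x => D x * deriv φ x) (Ioo a b) := fun D hD =>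
        Integrable.mul_bdd (c := C) hD hd.aestronglyMeasurable (Eventually.of_forall hC)
      have e : (fun x => (w x - (μp.real (Iio x) - μn.real (Iio x))) * deriv φ x) =
          fun x => w x * deriv φ x -
            (μp.real (Iio x) * deriv φ x - μn.real (Iio x) * deriv φ x) := by
        ext x
        ring
      have hsub : IntegrableOn
          (fun x => μp.real (Iio x) * deriv φ x - μn.real (Iio x) * deriv φ x) (Ioo a b) :=
        (hm _ (hFi μp)).sub (hm _ (hFi μn))
      rw [e, integral_sub (hm w h1) hsub, integral_sub (hm _ (hFi μp)) (hm _ (hFi μn)),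
        h7 φ hφ hs, integral_eq_neg_integral_measureReal_Iio_mul_deriv (ν := μp) hφ hcs,
        integral_eq_neg_integral_measureReal_Iio_mul_deriv (ν := μn) hφ hcs,
        setIntegral_Ioo_eq_integral_of_tsupport hds, setIntegral_Ioo_eq_integral_of_tsupport hds]
      ring)
  refine ⟨c, ?_⟩
  filter_upwards [hc] with x hx
  linarith

theorem measureReal_Icc_eq_sub {ν : Measure ℝ} [IsFiniteMeasure ν] {x y : ℝ} (hxy : x ≤ y)
    (hy : ν {y} = 0) : ν.real (Icc x y) = ν.real (Iio y) - ν.real (Iio x) := by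
  have h1 : ν.real (Iio y) = ν.real (Iio x) + ν.real (Ico x y) := by
    rw [← Iio_union_Ico_eq_Iio hxy, measureReal_union _ measurableSet_Ico]
    exact disjoint_left.2 fun t ht ht' => not_lt.2 ht'.1 ht
  have h2 : ν.real (Icc x y) = ν.real (Ico x y) := by
    refine measureReal_congr ?_
    rw [← Ico_union_right hxy]
    exact union_ae_eq_left_of_ae_eq_empty (ae_eq_empty.2 hy)
  linarith

theorem ae_measure_singleton_eq_zero (ν : Measure ℝ) [IsFiniteMeasure ν] :
    ∀ᵐ y ∂(volume : Measure ℝ), ν {y} = 0 := by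
  have h := (Measure.countable_meas_level_set_pos (μ := ν) measurable_id).measure_zero volume
  rw [ae_iff]
  refine measure_mono_null (fun y hy => ?_) h
  simpa [pos_iff_ne_zero] using hy

/-- The absolutely continuous part of the derivative of a Lipschitz function is bounded by the
Lipschitz constant. -/
theorem IsDerivMeasures.ae_abs_uaD_le {a b : ℝ} (hab : a < b) {L : ℝ≥0} {w : ℝ → ℝ}
    {μp μn : Measure ℝ} (h : IsDerivMeasures a b w μp μn) (hw : LipschitzWith L w) :
    ∀ᵐ x ∂(volume.restrict (Ioo a b)), |uaD μp μn x| ≤ L := by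
  obtain ⟨c, hc⟩ := h.exists_ae_eq hab
  have := h.2.1
  have := h.2.2.1
  rw [ae_restrict_iff' measurableSet_Ioo] at hc ⊢
  filter_upwards [Besicovitch.ae_tendsto_rnDeriv μp volume,
    Besicovitch.ae_tendsto_rnDeriv μn volume, μp.rnDeriv_lt_top volume,
    μn.rnDeriv_lt_top volume] with x hp hn hp' hn' hx
  have hlim := (((ENNReal.tendsto_toReal hp'.ne).comp hp).sub
    ((ENNReal.tendsto_toReal hn'.ne).comp hn)).abs
  have hgood : ∀ᵐ y ∂(volume : Measure ℝ),
      (y ∈ Ioo a b → w y = c + (μp.real (Iio y) - μn.real (Iio y))) ∧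
        μp {y} = 0 ∧ μn {y} = 0 :=
    hc.and ((ae_measure_singleton_eq_zero μp).and (ae_measure_singleton_eq_zero μn))
  have hgr : ∀ᵐ r ∂(volume : Measure ℝ), _ :=
    ((measurePreserving_add_left volume x).quasiMeasurePreserving.ae hgood).and
      ((Measure.measurePreserving_sub_left volume x).quasiMeasurePreserving.ae hgood)
  have hsmall : ∀ᶠ r in 𝓝[>] (0 : ℝ), 0 < r ∧ x + r ∈ Ioo a b ∧ x - r ∈ Ioo a b := by
    refine (eventually_mem_nhdsWithin).and (Eventually.and ?_ ?_)
    · have : Tendsto (fun r : ℝ => x + r) (𝓝[>] 0) (𝓝 x) :=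
        ((continuous_const.add continuous_id).tendsto' 0 x (by simp)).mono_left
          nhdsWithin_le_nhds
      exact this (isOpen_Ioo.mem_nhds hx)
    · have : Tendsto (fun r : ℝ => x - r) (𝓝[>] 0) (𝓝 x) :=
        ((continuous_const.sub continuous_id).tendsto' 0 x (by simp)).mono_left
          nhdsWithin_le_nhds
      exact this (isOpen_Ioo.mem_nhds hx)
  refine le_of_tendsto_of_frequently hlim fun hev => ?_
  obtain ⟨ε, hε, hsub⟩ := mem_nhdsGT_iff_exists_Ioo_subset.1 (hev.and hsmall)
  have hempty : ∀ᵐ r ∂(volume : Measure ℝ), r ∉ Ioo 0 ε := by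
    filter_upwards [hgr] with r hr hrI
    obtain ⟨hnot, hr0, hr1, hr2⟩ := hsub hrI
    refine hnot ?_
    have e1 := hr.1.1 hr1
    have e2 := hr.2.1 hr2
    have hle : x - r ≤ x + r := by linarith
    have hvol : (volume (Metric.closedBall x r)).toReal = 2 * r := by
      rw [Real.volume_closedBall, ENNReal.toReal_ofReal (by linarith)]
    simp only [Function.comp, ENNReal.toReal_div, hvol]
    rw [← sub_div, abs_div, abs_of_pos (by linarith : 0 < 2 * r), div_le_iff₀ (by linarith),
      Real.closedBall_eq_Icc]
    change |μp.real (Icc (x - r) (x + r)) - μn.real (Icc (x - r) (x + r))| ≤ _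
    rw [measureReal_Icc_eq_sub hle hr.1.2.1, measureReal_Icc_eq_sub hle hr.1.2.2]
    have h3 := hw.dist_le_mul (x + r) (x - r)
    rw [Real.dist_eq, Real.dist_eq, e1, e2, show x + r - (x - r) = 2 * r by ring,
      abs_of_pos (by linarith : 0 < 2 * r)] at h3
    refine le_trans (le_of_eq ?_) h3
    congr 1
    ring
  have : volume (Ioo 0 ε) = 0 :=
    measure_mono_null (fun r hr => not_not.2 hr) (ae_iff.1 hempty)
  rw [Real.volume_Ioo, sub_zero, ENNReal.ofReal_eq_zero] at this
  exact absurd hε (not_lt.2 this)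

theorem boundedVariationOn_of_abs_sub_le {f N : ℝ → ℝ} {s : Set ℝ} {C : ℝ} (hN : MonotoneOn N s)
    (hC : ∀ x ∈ s, |N x| ≤ C) (hf : ∀ x ∈ s, ∀ y ∈ s, x ≤ y → |f y - f x| ≤ N y - N x) :
    BoundedVariationOn f s := by
  refine ne_top_of_le_ne_top (hN.boundedVariationOn hC) (iSup_le ?_)
  rintro ⟨n, ⟨v, hv, vs⟩⟩
  refine le_trans (Finset.sum_le_sum fun i _ => ?_) (eVariationOn.sum_le hv vs)
  rw [edist_dist, edist_dist, Real.dist_eq, Real.dist_eq]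
  exact ENNReal.ofReal_le_ofReal
    ((hf _ (vs i) _ (vs (i + 1)) (hv i.le_succ)).trans (le_abs_self _))

/-- A function with distributional derivative a finite measure has a representative of bounded
variation. -/
theorem IsDerivMeasures.exists_boundedVariationOn {a b : ℝ} (hab : a < b) {w : ℝ → ℝ}
    {μp μn : Measure ℝ} (h : IsDerivMeasures a b w μp μn) :
    ∃ z : ℝ → ℝ, (∀ᵐ x ∂(volume.restrict (Ioo a b)), w x = z x) ∧
      BoundedVariationOn z (Ioo a b) := by
  obtain ⟨c, hc⟩ := h.exists_ae_eq hab
  have := h.2.1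
  have := h.2.2.1
  refine ⟨_, hc, boundedVariationOn_of_abs_sub_le
    (N := fun x => μp.real (Iio x) + μn.real (Iio x)) (C := μp.real univ + μn.real univ)
    (((monotone_measureReal_Iio μp).add (monotone_measureReal_Iio μn)).monotoneOn _)
    (fun x _ => ?_) fun x _ y _ hxy => ?_⟩
  · rw [abs_of_nonneg (add_nonneg measureReal_nonneg measureReal_nonneg)]
    exact add_le_add (measureReal_mono (subset_univ _)) (measureReal_mono (subset_univ _))
  · have h1 := monotone_measureReal_Iio μp hxy
    have h2 := monotone_measureReal_Iio μn hxy
    simp only at h1 h2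
    rw [abs_le]
    constructor <;> linarith

/-- On bounded sets, `Psi1 ψ` has a Lipschitz left inverse. -/
theorem PsiHyp.exists_lipschitz_leftInverse {ψ : ℝ → ℝ} (hψ : PsiHyp ψ) (L : ℝ) :
    ∃ (C : ℝ≥0) (Θ : ℝ → ℝ), LipschitzWith C Θ ∧ ∀ t, |t| ≤ L → Θ (Psi1 ψ t) = t := by
  obtain ⟨δ, hδ, hle⟩ := hψ.inf_pos (Icc (-L) L) isCompact_Icc
  have hord : ∀ s ∈ Icc (-L) L, ∀ t ∈ Icc (-L) L, s ≤ t →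
      δ * (t - s) ≤ Psi1 ψ t - Psi1 ψ s := fun s hs t ht hst => by
    rw [hψ.psi1_sub, mul_comm, ← smul_eq_mul, ← intervalIntegral.integral_const]
    exact intervalIntegral.integral_mono_on hst intervalIntegrable_const
      hψ.integrable.intervalIntegrable fun r hr => hle r ⟨hs.1.trans hr.1, hr.2.trans ht.2⟩
  have hexp : ∀ s ∈ Icc (-L) L, ∀ t ∈ Icc (-L) L, δ * |s - t| ≤ |Psi1 ψ s - Psi1 ψ t| := by
    intro s hs t ht
    rcases le_total s t with h | h
    · rw [abs_sub_comm, abs_of_nonneg (sub_nonneg.2 h), abs_sub_comm]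
      exact (hord s hs t ht h).trans (le_abs_self _)
    · rw [abs_of_nonneg (sub_nonneg.2 h)]
      exact (hord t ht s hs h).trans (le_abs_self _)
  have hinj : InjOn (Psi1 ψ) (Icc (-L) L) := fun s hs t ht hst => by
    have := hexp s hs t ht
    rw [hst, sub_self, abs_zero] at this
    have h2 : |s - t| ≤ 0 := by
      by_contra hc
      exact absurd this (not_le.2 (mul_pos hδ (not_le.1 hc)))
    exact sub_eq_zero.1 (abs_nonpos_iff.1 h2)
  set T := Function.invFunOn (Psi1 ψ) (Icc (-L) L) with hT
  have hTl : ∀ t ∈ Icc (-L) L, T (Psi1 ψ t) = t := fun t ht => hinj.leftInvOn_invFunOn ht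
  have hlip : LipschitzOnWith (Real.toNNReal δ⁻¹) T (Psi1 ψ '' Icc (-L) L) := by
    refine LipschitzOnWith.of_dist_le_mul ?_
    rintro _ ⟨s, hs, rfl⟩ _ ⟨t, ht, rfl⟩
    rw [hTl s hs, hTl t ht, Real.dist_eq, Real.dist_eq, Real.coe_toNNReal _ (inv_pos.2 hδ).le,
      inv_mul_eq_div, le_div_iff₀ hδ, mul_comm]
    exact hexp s hs t ht
  obtain ⟨Θ, hΘ, heq⟩ := hlip.extend_real
  refine ⟨_, Θ, hΘ, fun t ht => ?_⟩
  have htI : t ∈ Icc (-L) L := abs_le.1 ht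
  rw [← heq (mem_image_of_mem _ htI), hTl t htI]

/-- Lipschitz regularity, case `p = 1`: any solution of
`min { F̄₁(w) + λ∫(w-g)² : w ∈ X¹_ψ }` with Lipschitz datum `g` is Lipschitz
continuous and its derivative belongs to `BV(]a,b[)`. -/
theorem statement_14 (a b lam : ℝ) (hab : a < b) (hlam : 0 < lam)
    (ψ : ℝ → ℝ) (hψ : PsiHyp ψ)
    (g : ℝ → ℝ) (hg : ∃ K : ℝ≥0, LipschitzOnWith K g (Set.Icc a b))
    (u : ℝ → ℝ) (μp μn : Measure ℝ) (hX : MemX1 ψ a b u μp μn)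
    (hmin : ∀ w : ℝ → ℝ, (∃ ηp ηn : Measure ℝ, MemX1 ψ a b w ηp ηn) →
      FpRel ψ 1 a b u + ENNReal.ofReal (lam * ∫ x in Set.Ioo a b, (u x - g x) ^ 2) ≤
      FpRel ψ 1 a b w + ENNReal.ofReal (lam * ∫ x in Set.Ioo a b, (w x - g x) ^ 2)) :
    (∃ (ubar : ℝ → ℝ) (K : ℝ≥0),
      (∀ᵐ x ∂(MeasureTheory.volume.restrict (Set.Ioo a b)), ubar x = u x) ∧
      LipschitzOnWith K ubar (Set.Icc a b)) ∧
    (∃ z : ℝ → ℝ,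
      (∀ᵐ x ∂(MeasureTheory.volume.restrict (Set.Ioo a b)), z x = uaD μp μn x) ∧
      BoundedVariationOn z (Set.Ioo a b)) := by
  obtain ⟨K, hK⟩ := hg
  obtain ⟨g', hg', heq⟩ := hK.extend_real
  have hgg : ∀ w : ℝ → ℝ, ∫ x in Ioo a b, (w x - g x) ^ 2 = ∫ x in Ioo a b, (w x - g' x) ^ 2 :=
    fun w => setIntegral_congr_fun measurableSet_Ioo fun x hx => by
      simp only [heq (Ioo_subset_Icc_self hx)]
  obtain ⟨ubar, hub, hae⟩ := exists_lipschitz_of_relaxed_min hab hlam hψ hg' hX.1.1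
    fun f v q h => by
      have h1 := hmin f (h.exists_memX1 hab hψ)
      rw [hgg, hgg] at h1
      refine h1.trans ((add_le_add_left h.FpRel_le _).trans ?_)
      rw [← ENNReal.ofReal_add
        (add_nonneg (integral_nonneg fun _ => abs_nonneg _)
          (integral_nonneg fun x => mul_nonneg (hψ.pos _).le (abs_nonneg _)))
        (mul_nonneg hlam.le (integral_nonneg fun _ => sq_nonneg _))]
      rfl
  refine ⟨⟨ubar, K + 1, hae, hub.lipschitzOnWith⟩, ?_⟩
  have hbd := (hX.1.congr_ae (hae.mono fun x hx => hx.symm)).ae_abs_uaD_le hab hub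
  obtain ⟨νp, νn, hν⟩ := hX.2.1
  obtain ⟨G, hG, hGbv⟩ := hν.exists_boundedVariationOn hab
  obtain ⟨C, Θ, hΘ, hinv⟩ := hψ.exists_lipschitz_leftInverse (K + 1 : ℝ≥0)
  refine ⟨Θ ∘ G, ?_, hΘ.comp_boundedVariationOn hGbv⟩
  filter_upwards [hbd, hG] with x h1 h2
  rw [Function.comp, ← h2, hinv _ h1]
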